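/- arXiv:1703.08281 — 3 statements merged into one kernel-verified Lean document; each statement's English description precedes it below -/
import Mathlib

section
/- Let (A,𝔪) be a Noetherian regular local ring of Krull dimension d+1. Then for every A-module N there is an isomorphism Tor_1^A(H^{d+1}_𝔪(A), N) ≅ H^d_𝔪(N). -/
/-- A Noetherian local ring is regular if its maximal ideal can be generated by
`Krull dimension` many elements. -/
def IsRegularLocal (A : Type*) [CommRing A] [IsLocalRing A] : Prop :=
  IsNoetherianRing A ∧
    ∃ s : Finset A, Ideal.span (s : Set A) = IsLocalRing.maximalIdeal A ∧
      (s.card : WithBot ℕ∞) = ringKrullDim A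

open CategoryTheory

universe u

section

open Abelian Limits Opposite
open scoped TensorProduct

open IsLocalRing in
/-- In a Noetherian local ring of positive dimension, some element of the maximal ideal avoids
both its square and all minimal primes. -/
lemma IsLocalRing.exists_mem_maximalIdeal_notMem_sq {A : Type*} [CommRing A] [IsNoetherianRing A]
    [IsLocalRing A] (h : 0 < ringKrullDim A) :
    ∃ x ∈ maximalIdeal A, x ∉ maximalIdeal A ^ 2 ∧ ∀ p ∈ minimalPrimes A, x ∉ p := by
  classical
  by_contra! hx
  have hfin := minimalPrimes.finite_of_isNoetherianRing A
  have hsub : (maximalIdeal A : Set A) ⊆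
      ⋃ i ∈ (↑(insert (maximalIdeal A ^ 2) hfin.toFinset) : Set (Ideal A)), (id i : Ideal A) := by
    intro x hxm
    simp only [Set.mem_iUnion]
    by_cases h2 : x ∈ maximalIdeal A ^ 2
    · exact ⟨_, by simp, h2⟩
    · obtain ⟨p, hp, hxp⟩ := hx x hxm h2
      exact ⟨p, by simp [hp], hxp⟩
  rw [Ideal.subset_union_prime (maximalIdeal A ^ 2) (maximalIdeal A ^ 2)
    (by
      intro i hi hne _
      simp only [Finset.mem_insert, hne, Set.Finite.mem_toFinset, false_or] at hi
      exact hi.1.1)] at hsub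
  obtain ⟨p, hp, hle⟩ := hsub
  simp only [Finset.mem_insert, Set.Finite.mem_toFinset, id] at hp hle
  refine h.ne' ?_
  rcases hp with rfl | hp
  · have hbot : maximalIdeal A = ⊥ := by
      refine Submodule.eq_bot_of_le_smul_of_le_jacobson_bot (maximalIdeal A) _
        (IsNoetherian.noetherian _) ?_ (IsLocalRing.maximalIdeal_le_jacobson _)
      rwa [smul_eq_mul, ← sq]
    exact ringKrullDim_eq_zero_of_isField (isField_iff_maximalIdeal_eq.mpr hbot)
  · have := hp.1.1
    have hpm : p = maximalIdeal A := le_antisymm (le_maximalIdeal this.ne_top) hle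
    rw [← maximalIdeal_height_eq_ringKrullDim, ← hpm, (Ideal.height_eq_zero_iff).mpr hp]
    rfl

open IsLocalRing in
/-- An element of the maximal ideal outside its square can replace one of any given generators. -/
lemma IsLocalRing.exists_finset_span_insert_eq_maximalIdeal {A : Type*} [CommRing A]
    [IsLocalRing A] {s : Finset A} (hs : Ideal.span (s : Set A) = maximalIdeal A) {x : A}
    (hx : x ∈ maximalIdeal A) (hx2 : x ∉ maximalIdeal A ^ 2) :
    ∃ t : Finset A, t.card + 1 = s.card ∧
      Ideal.span (insert x (t : Set A)) = maximalIdeal A := by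
  classical
  have hsm : ∀ a ∈ s, a ∈ maximalIdeal A := fun a ha => hs ▸ Ideal.subset_span ha
  obtain ⟨c, hc⟩ := (Submodule.mem_span_finset'.mp (hs ▸ hx : x ∈ Ideal.span (s : Set A)))
  obtain ⟨a, ha⟩ : ∃ a : s, IsUnit (c a) := by
    by_contra! hu
    refine hx2 (hc ▸ Ideal.sum_mem _ fun a _ => ?_)
    rw [sq]
    exact Ideal.mul_mem_mul ((mem_maximalIdeal _).mpr (hu a)) (hsm a a.2)
  refine ⟨s.erase a, Finset.card_erase_add_one a.2, le_antisymm ?_ ?_⟩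
  · rw [Ideal.span_le]
    rintro y (rfl | hy)
    · exact hx
    · exact hsm y (Finset.mem_of_mem_erase hy)
  · rw [← hs, Ideal.span_le]
    intro y hy
    by_cases hya : y = a
    · subst hya
      obtain ⟨u, hu⟩ := ha
      have : (a : A) = ↑u⁻¹ * (x - ∑ b ∈ Finset.univ.erase a, c b * b) := by
        rw [← hc, ← Finset.add_sum_erase _ _ (Finset.mem_univ a)]
        simp [← hu]
      suffices h : ↑u⁻¹ * (x - ∑ b ∈ Finset.univ.erase a, c b * b) ∈
          Ideal.span (insert x (↑(s.erase a) : Set A)) by rwa [← this] at h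
      refine Ideal.mul_mem_left _ _ (sub_mem (Ideal.subset_span (by simp))
        (Ideal.sum_mem _ fun b hb => Ideal.mul_mem_left _ _ (Ideal.subset_span ?_)))
      right
      simp only [Finset.mem_erase, Finset.mem_univ, and_true] at hb
      exact Finset.mem_coe.mpr (Finset.mem_erase.mpr ⟨Subtype.coe_injective.ne hb, b.2⟩)
    · exact Ideal.subset_span (by right; simpa [hya] using hy)

/-- If a prime is principal, generated by an element outside all minimal primes of a Noetherian
local ring, then the ring is a domain. -/
lemma IsLocalRing.isDomain_of_isPrime_span_singleton {A : Type*} [CommRing A] [IsNoetherianRing A]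
    [IsLocalRing A] {x : A} [hp : (Ideal.span {x}).IsPrime]
    (hx : ∀ p ∈ minimalPrimes A, x ∉ p) : IsDomain A := by
  obtain ⟨p, hpm, hle⟩ := Ideal.exists_minimalPrimes_le (bot_le (a := Ideal.span {x}))
  have hpp : p.IsPrime := hpm.1.1
  suffices p = ⊥ by
    subst this
    exact IsDomain.of_bot_isPrime A
  refine Submodule.eq_bot_of_le_smul_of_le_jacobson_bot (Ideal.span {x}) _
    (IsNoetherian.noetherian _) ?_
    ((IsLocalRing.le_maximalIdeal hp.ne_top).trans (IsLocalRing.maximalIdeal_le_jacobson _))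
  intro y hy
  obtain ⟨z, rfl⟩ := Ideal.mem_span_singleton'.mp (hle hy)
  rw [smul_eq_mul, mul_comm z x]
  exact Ideal.mul_mem_mul (Ideal.mem_span_singleton_self x)
    ((hpp.mem_or_mem hy).resolve_right (hx p hpm))

open IsLocalRing RingTheory.Sequence in
/-- A regular local ring is a domain, and its maximal ideal is generated by a regular sequence. -/
lemma IsLocalRing.isDomain_and_exists_isRegular {A : Type*} [CommRing A] [IsNoetherianRing A]
    [IsLocalRing A] (n : ℕ) (s : Finset A) (hs : Ideal.span (s : Set A) = maximalIdeal A)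
    (hcard : s.card = n) (hdim : (n : WithBot ℕ∞) ≤ ringKrullDim A) :
    IsDomain A ∧ ∃ rs : List A, rs.length = n ∧ Ideal.ofList rs = maximalIdeal A ∧
      IsRegular A rs := by
  classical
  induction n generalizing A with
  | zero =>
    have hbot : maximalIdeal A = ⊥ := by
      rw [← hs, Finset.card_eq_zero.mp hcard]; simp
    exact ⟨(isField_iff_maximalIdeal_eq.mpr hbot).isDomain, [], rfl, by simp [hbot], .nil A A⟩
  | succ n ih =>
    obtain ⟨x, hx, hx2, hxp⟩ := exists_mem_maximalIdeal_notMem_sq (A := A)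
      (lt_of_lt_of_le (by exact_mod_cast Nat.succ_pos n) hdim)
    obtain ⟨t, ht, hspan⟩ := exists_finset_span_insert_eq_maximalIdeal hs hx hx2
    have hne : Ideal.span {x} ≠ ⊤ := fun h =>
      (Ideal.span_singleton_eq_top.mp h |> (mem_maximalIdeal x).mp hx)
    have : Nontrivial (A ⧸ Ideal.span {x}) := Ideal.Quotient.nontrivial_iff.mpr hne
    have : IsLocalRing (A ⧸ Ideal.span {x}) :=
      .of_surjective' (Ideal.Quotient.mk _) Ideal.Quotient.mk_surjective
    have hmap : (maximalIdeal A).map (Ideal.Quotient.mk (Ideal.span {x})) =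
        maximalIdeal (A ⧸ Ideal.span {x}) :=
      map_maximalIdeal_of_surjective _ Ideal.Quotient.mk_surjective
    have hdim' : (n : WithBot ℕ∞) ≤ ringKrullDim (A ⧸ Ideal.span {x}) := by
      have h := Ideal.height_le_ringKrullDim_quotient_add_one hx
      rw [maximalIdeal_height_eq_ringKrullDim] at h
      have h' := hdim.trans h
      rw [Nat.cast_succ] at h'
      exact ENat.WithBot.add_le_add_one_right_iff.mp h'
    have hspan' : Ideal.span ((t.image (Ideal.Quotient.mk (Ideal.span {x})) : Finset _) :
        Set (A ⧸ Ideal.span {x})) = maximalIdeal (A ⧸ Ideal.span {x}) := by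
      rw [← hmap, ← hspan, Ideal.map_span, Set.image_insert_eq, Ideal.span_insert]
      simp
    have hle : (t.image (Ideal.Quotient.mk (Ideal.span {x}))).card ≤ n :=
      Finset.card_image_le.trans (by omega)
    have hge : n ≤ (t.image (Ideal.Quotient.mk (Ideal.span {x}))).card := by
      have h := ringKrullDim_le_ringKrullDim_quotient_add_card
        (t.image (Ideal.Quotient.mk (Ideal.span {x}))) (by
          rw [IsLocalRing.ringJacobson_eq_maximalIdeal, ← hspan']; exact Ideal.subset_span)
      rw [hspan'] at h
      have h0 : ringKrullDim ((A ⧸ Ideal.span {x}) ⧸ maximalIdeal (A ⧸ Ideal.span {x})) = 0 :=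
        ringKrullDim_eq_zero_of_isField
          ((Ideal.Quotient.maximal_ideal_iff_isField_quotient _).mp inferInstance)
      rw [h0, zero_add] at h
      exact_mod_cast hdim'.trans h
    obtain ⟨hdom, rs, hlen, hrs, hreg⟩ := ih _ hspan' (le_antisymm hle hge) hdim'
    have : (Ideal.span {x}).IsPrime := (Ideal.Quotient.isDomain_iff_prime _).mp hdom
    have hA : IsDomain A := isDomain_of_isPrime_span_singleton hxp
    obtain ⟨rs, rfl⟩ := List.map_surjective_iff.mpr Ideal.Quotient.mk_surjective rs
    refine ⟨hA, x :: rs, by simpa using hlen, ?_, ?_⟩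
    · rw [Ideal.ofList_cons]
      apply_fun Ideal.comap (Ideal.Quotient.mk (Ideal.span {x})) at hrs
      rw [← Ideal.map_ofList, Ideal.comap_map_of_surjective _ Ideal.Quotient.mk_surjective,
        ← RingHom.ker_eq_comap_bot, Ideal.mk_ker, ← hmap,
        Ideal.comap_map_of_surjective _ Ideal.Quotient.mk_surjective,
        ← RingHom.ker_eq_comap_bot, Ideal.mk_ker, sup_comm] at hrs
      rw [hrs, sup_eq_left, Ideal.span_singleton_le_iff_mem]
      exact hx
    · have hx0 : x ≠ 0 := by rintro rfl; exact hx2 (zero_mem _)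
      refine .cons (IsSMulRegular.of_ne_zero hx0) ?_
      let e : (A ⧸ Ideal.span {x}) ≃ₗ[A] QuotSMulTop x A :=
        Submodule.quotEquivOfEq _ _ (by
          rw [← Submodule.ideal_span_singleton_smul, smul_eq_mul, Ideal.mul_top])
      rw [← e.isRegular_congr]
      refine (AddEquiv.isRegular_congr (e := AddEquiv.refl _) ?_).mp hreg
      exact List.forall₂_map_left_iff.mpr (List.forall₂_same.mpr fun r _ y => rfl)

/-- An extension of a finitely generated module by a free module over a Noetherian ring involves
only finitely many coordinates. -/
lemma ModuleCat.ext_finsupp_eq_sum {A : Type u} [CommRing A] [IsNoetherianRing A]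
    (Q : ModuleCat.{u} A) [Module.Finite A Q] (ι : Type u) (n : ℕ)
    (α : Ext Q (ModuleCat.of A (ι →₀ A)) n) :
    ∃ S : Finset ι, ∑ s ∈ S, α.comp (Ext.mk₀ (ModuleCat.ofHom
      (Finsupp.lsingle (R := A) (M := A) s ∘ₗ Finsupp.lapply s))) (add_zero n) = α := by
  classical
  induction n generalizing Q with
  | zero =>
    obtain ⟨f, rfl⟩ := (Ext.mk₀_bijective Q (ModuleCat.of A (ι →₀ A))).2 α
    obtain ⟨T, hT⟩ := (Module.Finite.fg_top : (⊤ : Submodule A Q).FG)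
    refine ⟨T.biUnion fun x => (f.hom x).support, ?_⟩
    simp only [Ext.mk₀_comp_mk₀]
    simp only [← Ext.addEquiv₀_symm_apply]
    rw [← map_sum]
    congr 1
    refine ModuleCat.hom_ext (LinearMap.ext_on_range (v := ((↑) : T → Q)) (by simpa using hT) ?_)
    intro x
    rw [ModuleCat.hom_sum, LinearMap.sum_apply]
    simp only [ModuleCat.hom_comp, ModuleCat.hom_ofHom, LinearMap.comp_apply,
      Finsupp.lapply_apply, Finsupp.lsingle_apply]
    conv_rhs => rw [← Finsupp.sum_single (f.hom x.1)]
    refine (Finset.sum_subset (Finset.subset_biUnion_of_mem (u := fun y => (f.hom y).support)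
      x.2) fun i _ hi => ?_).symm
    simpa using hi
  | succ n ih =>
    obtain ⟨N, _, _, _, _, f, surjf⟩ := Module.exists_finite_presentation A Q
    let exac := LinearMap.shortExact_shortComplexKer surjf
    obtain ⟨β, rfl⟩ := precomp_extClass_surjective_of_projective_X₂
      (ModuleCat.of A (ι →₀ A)) exac n α
    obtain ⟨S, hS⟩ := ih _ β
    refine ⟨S, ?_⟩
    conv_rhs => rw [← hS]
    rw [map_sum]
    exact Finset.sum_congr rfl fun s _ => Ext.comp_assoc_of_third_deg_zero _ _ _ (add_comm 1 n)

open IsLocalRing in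
lemma ModuleCat.subsingleton_ext_quotient_pow_self {A : Type u} [CommRing A] [IsNoetherianRing A]
    [IsLocalRing A] {rs : List A} (hrs : Ideal.ofList rs = maximalIdeal A)
    (reg : RingTheory.Sequence.IsRegular A rs) (t : ℕ) {i : ℕ} (hi : i < rs.length) :
    Subsingleton (Ext (ModuleCat.of A (A ⧸ maximalIdeal A ^ t)) (ModuleCat.of A A) i) := by
  refine ModuleCat.subsingleton_ext_of_exists_isRegular (maximalIdeal A) _ ?_ _ ?_ rs ?_ reg i hi
  · change Module.support A (A ⧸ maximalIdeal A ^ t) ⊆ _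
    rw [Module.support_eq_zeroLocus, Ideal.annihilator_quotient]
    exact fun p hp => Ideal.IsPrime.le_of_pow_le (n := t) hp
  · simpa [lt_top_iff_ne_top] using Ideal.IsPrime.ne_top'
  · intro r hr
    rw [← hrs]
    exact Ideal.subset_span hr

/-- Vanishing of `Ext` into the ring passes to projective modules. -/
lemma ModuleCat.subsingleton_ext_of_projective {A : Type u} [CommRing A] [IsNoetherianRing A]
    (Q : ModuleCat.{u} A) [Module.Finite A Q] (n : ℕ)
    (h : Subsingleton (Ext Q (ModuleCat.of A A) n)) (P : ModuleCat.{u} A) [Module.Projective A P] :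
    Subsingleton (Ext Q P n) := by
  refine subsingleton_of_forall_eq 0 fun α => ?_
  obtain ⟨s, hs⟩ := Module.projective_def'.1 (inferInstance : Module.Projective A P)
  have hret : ModuleCat.ofHom s ≫ ModuleCat.ofHom (Finsupp.linearCombination A id) = 𝟙 P :=
    ModuleCat.hom_ext hs
  obtain ⟨S, hS⟩ := ModuleCat.ext_finsupp_eq_sum Q P n
    (α.comp (Ext.mk₀ (ModuleCat.ofHom s)) (add_zero n))
  have h0 : α.comp (Ext.mk₀ (ModuleCat.ofHom s)) (add_zero n) = 0 := by
    rw [← hS]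
    refine Finset.sum_eq_zero fun i _ => ?_
    rw [ModuleCat.ofHom_comp, ← Ext.mk₀_comp_mk₀, ← Ext.comp_assoc_of_third_deg_zero,
      Subsingleton.elim (Ext.comp _ (Ext.mk₀ (ModuleCat.ofHom (Finsupp.lapply i))) _)
        (0 : Ext Q (ModuleCat.of A A) n), Ext.zero_comp]
  rw [← Ext.comp_mk₀_id α, ← hret, ← Ext.mk₀_comp_mk₀, ← Ext.comp_assoc_of_third_deg_zero,
    h0, Ext.zero_comp]

open IsLocalRing in
lemma ModuleCat.hasProjectiveDimensionLE_residue {A : Type u} [CommRing A] [IsNoetherianRing A]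
    [IsLocalRing A] {rs : List A} (hrs : Ideal.ofList rs = maximalIdeal A)
    (reg : RingTheory.Sequence.IsRegular A rs) :
    HasProjectiveDimensionLE (ModuleCat.of A (A ⧸ maximalIdeal A)) rs.length := by
  have h := (projectiveDimension_le_iff _ _).1
    (ModuleCat.projectiveDimension_quotient_eq_length.{u} rs reg).le
  rw [hrs] at h
  exact hasProjectiveDimensionLT_of_iso (Shrink.linearEquiv A _).toModuleIso _

open IsLocalRing in
lemma ModuleCat.hasProjectiveDimensionLE_of_isFiniteLength {A : Type u} [CommRing A]
    [IsLocalRing A] {n : ℕ}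
    (h : HasProjectiveDimensionLE (ModuleCat.of A (A ⧸ maximalIdeal A)) n)
    (M : Type u) [AddCommGroup M] [Module A M] (hM : IsFiniteLength A M) :
    HasProjectiveDimensionLE (ModuleCat.of A M) n := by
  induction hM with
  | of_subsingleton =>
    have := (ModuleCat.isZero_of_subsingleton (ModuleCat.of A ‹Type u›)).hasProjectiveDimensionLT_zero
    exact hasProjectiveDimensionLT_of_ge _ 0 _ (by simp)
  | @of_simple_quotient M _ _ N _ hN ih =>
    obtain ⟨I, hI, ⟨e⟩⟩ := isSimpleModule_iff_quot_maximal.1 (inferInstance : IsSimpleModule A (M ⧸ N))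
    obtain rfl := IsLocalRing.eq_maximalIdeal hI
    have h3 : HasProjectiveDimensionLE (ModuleCat.of A (M ⧸ N)) n :=
      hasProjectiveDimensionLT_of_iso e.symm.toModuleIso _
    have hS := LinearMap.shortExact_shortComplexKer N.mkQ_surjective
    refine hS.hasProjectiveDimensionLT_X₂ _ ?_ h3
    exact hasProjectiveDimensionLT_of_iso
      (LinearEquiv.ofEq _ _ N.ker_mkQ.symm).toModuleIso _

open IsLocalRing in
lemma IsLocalRing.isFiniteLength_quotient_maximalIdeal_pow {A : Type u} [CommRing A]
    [IsNoetherianRing A] [IsLocalRing A] (t : ℕ) : IsFiniteLength A (A ⧸ maximalIdeal A ^ t) := by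
  rcases Nat.eq_zero_or_pos t with rfl | ht
  · have : Subsingleton (A ⧸ maximalIdeal A ^ 0) := Ideal.Quotient.subsingleton_iff.2 (by simp)
    exact .of_subsingleton
  rw [isFiniteLength_iff_isNoetherian_isArtinian]
  refine ⟨inferInstance, ?_⟩
  have hne : maximalIdeal A ^ t ≠ ⊤ := fun h => (maximalIdeal.isMaximal A).ne_top
    (top_le_iff.1 (h ▸ Ideal.pow_le_self ht.ne'))
  have : Nontrivial (A ⧸ maximalIdeal A ^ t) := Ideal.Quotient.nontrivial_iff.2 hne
  have : IsLocalRing (A ⧸ maximalIdeal A ^ t) :=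
    .of_surjective' (Ideal.Quotient.mk _) Ideal.Quotient.mk_surjective
  have hart : IsArtinianRing (A ⧸ maximalIdeal A ^ t) := by
    rw [isArtinianRing_iff_isNilpotent_maximalIdeal]
    refine ⟨t, ?_⟩
    rw [← IsLocalRing.map_maximalIdeal_of_surjective (Ideal.Quotient.mk (maximalIdeal A ^ t))
      Ideal.Quotient.mk_surjective, ← Ideal.map_pow,
      Ideal.map_quotient_self]
    rfl
  exact isArtinian_of_surjective_algebraMap (R := A ⧸ maximalIdeal A ^ t)
    Ideal.Quotient.mk_surjective

namespace CategoryTheory.ProjectiveResolution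

section

variable {R : Type*} [CommRing R] {C : Type*} [Category* C] [Abelian C] [Linear R C]
  {X : C} (P : ProjectiveResolution X) (Y : C) (n : ℕ)

variable (R) in
/-- The complex `Hom(P, Y)`, as a complex in the opposite category of modules. -/
noncomputable abbrev opHom : ChainComplex (ModuleCat R)ᵒᵖ ℕ :=
  (((linearYoneda R C).obj Y).rightOp.mapHomologicalComplex _).obj P.complex

variable (R) in
/-- The cocycles of the complex `Hom(P, Y)`. -/
noncomputable abbrev cocycles : ModuleCat R := unop ((P.opHom R Y).opcycles n)

variable (R) in
/-- The inclusion of cocycles. -/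
noncomputable def cocyclesι : P.cocycles R Y n →ₗ[R] (P.complex.X n ⟶ Y) :=
  ((P.opHom R Y).pOpcycles n).unop.hom

lemma cocyclesι_injective : Function.Injective (P.cocyclesι R Y n) :=
  (ModuleCat.mono_iff_injective ((P.opHom R Y).pOpcycles n).unop).1 inferInstance

lemma d_comp_cocyclesι (z : P.cocycles R Y n) :
    P.complex.d (n + 1) n ≫ P.cocyclesι R Y n z = 0 := by
  have h := congr($(congr(($((P.opHom R Y).d_pOpcycles (n + 1) n)).unop)).hom z)
  exact h

lemma exists_cocyclesι_eq (f : P.complex.X n ⟶ Y) (hf : P.complex.d (n + 1) n ≫ f = 0) :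
    ∃ z, P.cocyclesι R Y n z = f := by
  have hex := (ShortComplex.exact_of_g_is_cokernel (ShortComplex.mk _ _
    ((P.opHom R Y).d_pOpcycles (n + 1) n))
    ((P.opHom R Y).opcyclesIsCokernel (n + 1) n (by simp))).unop
  rw [ShortComplex.moduleCat_exact_iff] at hex
  exact hex f hf

section

variable [HasExt C]

lemma extMk_eq_zero_iff_exists (f : P.complex.X n ⟶ Y) (hf : P.complex.d (n + 1) n ≫ f = 0) :
    P.extMk f (n + 1) rfl hf = 0 ↔
      ∃ g, P.complex.d n ((ComplexShape.down ℕ).next n) ≫ g = f := by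
  rcases n with - | n
  · have h0 : P.complex.d 0 ((ComplexShape.down ℕ).next 0) = 0 := P.complex.shape _ _ (by simp)
    have hz : IsZero (P.cochainComplex.X 1) :=
      P.cochainComplex.isZero_of_isStrictlyLE 0 1
    simp only [← P.extEquivCohomologyClass.apply_eq_iff_eq,
      extEquivCohomologyClass_extMk, extEquivCohomologyClass_zero,
      CochainComplex.HomComplex.CohomologyClass.mk_eq_zero_iff]
    rw [CochainComplex.HomComplex.Cocycle.toSingleMk_mem_coboundaries_iff _ _ _ _ _ 1 (by simp),
      h0]
    constructor
    · rintro ⟨g, hg⟩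
      obtain rfl := hz.eq_of_src g 0
      refine ⟨0, ?_⟩
      rw [← cancel_epi (P.cochainComplexXIso (-(0 : ℕ)) 0 rfl).hom, ← hg]
      simp
    · rintro ⟨g, rfl⟩
      exact ⟨0, by simp⟩
  · have h0 : (ComplexShape.down ℕ).next (n + 1) = n := by simp
    rw [P.extMk_eq_zero_iff f (n + 2) rfl hf n rfl, h0]

variable (R) in
/-- The class of a cocycle in `Abelian.Ext`. -/
noncomputable def abelianExtClassOfCocycle : P.cocycles R Y n →ₗ[R] Abelian.Ext X Y n where
  toFun z := P.extMk (P.cocyclesι R Y n z) (n + 1) rfl (P.d_comp_cocyclesι Y n z)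
  map_add' x y := by simp [add_extMk]
  map_smul' r x := by
    rw [RingHom.id_apply, Ext.smul_eq_comp_mk₀, extMk_comp_mk₀]
    congr 1
    simp

lemma abelianExtClassOfCocycle_surjective :
    Function.Surjective (P.abelianExtClassOfCocycle R Y n) := by
  intro α
  obtain ⟨f, hf, rfl⟩ := P.extMk_surjective α (n + 1) rfl
  obtain ⟨z, rfl⟩ := P.exists_cocyclesι_eq (R := R) Y n f hf
  exact ⟨z, rfl⟩

end

variable [EnoughProjectives C]

variable (R) in
/-- The derived functor `Ext` is computed by the homology of `Hom(P, Y)`. -/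
noncomputable def leftDerivedIsoOpHom :
    (((linearYoneda R C).obj Y).rightOp.leftDerived n).obj X ≅ (P.opHom R Y).homology n :=
  P.isoLeftDerivedObj ((linearYoneda R C).obj Y).rightOp n

variable (R) in
/-- The class of a cocycle in the derived functor `Ext`. -/
noncomputable def extClassOfCocycle :
    P.cocycles R Y n →ₗ[R] ((_root_.Ext R C n).obj (op X)).obj Y :=
  (((P.leftDerivedIsoOpHom R Y n).hom ≫ (P.opHom R Y).homologyι n).unop).hom

lemma extClassOfCocycle_surjective : Function.Surjective (P.extClassOfCocycle R Y n) := by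
  have : Epi ((P.leftDerivedIsoOpHom R Y n).hom ≫ (P.opHom R Y).homologyι n).unop :=
    unop_epi_of_mono _
  exact (ModuleCat.epi_iff_surjective _).1 this

lemma extClassOfCocycle_eq_zero_iff (z : P.cocycles R Y n) :
    P.extClassOfCocycle R Y n z = 0 ↔
      ∃ g, P.complex.d n ((ComplexShape.down ℕ).next n) ≫ g = P.cocyclesι R Y n z := by
  have hex := (ShortComplex.exact_of_f_is_kernel (ShortComplex.mk _ _
    ((P.opHom R Y).homologyι_comp_fromOpcycles n ((ComplexShape.down ℕ).next n)))
    ((P.opHom R Y).homologyIsKernel n _ rfl)).unop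
  rw [ShortComplex.moduleCat_exact_iff_ker_sub_range] at hex
  have hd (g : P.complex.X ((ComplexShape.down ℕ).next n) ⟶ Y) :
      P.cocyclesι R Y n (((P.opHom R Y).fromOpcycles n ((ComplexShape.down ℕ).next n)).unop.hom g) =
        P.complex.d n ((ComplexShape.down ℕ).next n) ≫ g := by
    exact congr($(congr(($((P.opHom R Y).p_fromOpcycles n
      ((ComplexShape.down ℕ).next n))).unop)).hom g)
  have hinj : Function.Injective
      ((P.leftDerivedIsoOpHom R Y n).hom.unop).hom :=
    (ModuleCat.mono_iff_injective _).1 inferInstance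
  refine (map_eq_zero_iff (P.leftDerivedIsoOpHom R Y n).hom.unop.hom hinj :
    _ ↔ ((P.opHom R Y).homologyι n).unop.hom z = 0).trans ?_
  constructor
  · intro hz
    obtain ⟨g, hg⟩ := hex hz
    exact ⟨g, (hd g).symm.trans (congrArg _ hg)⟩
  · rintro ⟨g, hg⟩
    obtain rfl := P.cocyclesι_injective Y n ((hd g).trans hg)
    exact congr($(congr(($((P.opHom R Y).homologyι_comp_fromOpcycles n
      ((ComplexShape.down ℕ).next n))).unop)).hom g)

lemma leftDerivedIsoOpHom_hom_map_left {X' : C} {P' : ProjectiveResolution X'} {g : X' ⟶ X}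
    (φ : Hom P' P g) :
    (((linearYoneda R C).obj Y).rightOp.leftDerived n).map g ≫ (P.leftDerivedIsoOpHom R Y n).hom =
      (P'.leftDerivedIsoOpHom R Y n).hom ≫ HomologicalComplex.homologyMap
        ((((linearYoneda R C).obj Y).rightOp.mapHomologicalComplex _).map φ.hom) n :=
  isoLeftDerivedObj_hom_naturality g P' P φ.hom
    (φ.hom_f_zero_comp_π_f_zero.trans (by rw [ChainComplex.single₀_map_f_zero]; rfl))
    ((linearYoneda R C).obj Y).rightOp n

lemma extClassOfCocycle_map_left {X' : C} {P' : ProjectiveResolution X'} {g : X' ⟶ X}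
    (φ : Hom P' P g) (z : P.cocycles R Y n) (z' : P'.cocycles R Y n)
    (h : P'.cocyclesι R Y n z' = φ.hom.f n ≫ P.cocyclesι R Y n z) :
    (((_root_.Ext R C n).map g.op).app Y).hom (P.extClassOfCocycle R Y n z) =
      P'.extClassOfCocycle R Y n z' := by
  let Φ : P'.opHom R Y ⟶ P.opHom R Y :=
    (((linearYoneda R C).obj Y).rightOp.mapHomologicalComplex _).map φ.hom
  have h3 := HomologicalComplex.p_opcyclesMap Φ n
  obtain rfl : ((HomologicalComplex.opcyclesMap Φ n).unop).hom z = z' :=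
    P'.cocyclesι_injective Y n ((congr($(congr(($h3).unop)).hom z)).trans h.symm)
  have h4 : (((linearYoneda R C).obj Y).rightOp.leftDerived n).map g ≫
      ((P.leftDerivedIsoOpHom R Y n).hom ≫ (P.opHom R Y).homologyι n) =
      ((P'.leftDerivedIsoOpHom R Y n).hom ≫ (P'.opHom R Y).homologyι n) ≫
        HomologicalComplex.opcyclesMap Φ n := by
    rw [← Category.assoc, leftDerivedIsoOpHom_hom_map_left _ _ _ φ, Category.assoc, Category.assoc,
      HomologicalComplex.homologyι_naturality]
  exact congr($(congr(($h4).unop)).hom z)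

variable {Y} in
lemma leftDerivedIsoOpHom_inv_map_right {Y' : C} (g : Y ⟶ Y') :
    (NatTrans.leftDerived (NatTrans.rightOp ((linearYoneda R C).map g)) n).app X =
      (P.leftDerivedIsoOpHom R Y' n).hom ≫ HomologicalComplex.homologyMap
        ((NatTrans.mapHomologicalComplex (NatTrans.rightOp ((linearYoneda R C).map g))
          (ComplexShape.down ℕ)).app P.complex) n ≫ (P.leftDerivedIsoOpHom R Y n).inv :=
  P.leftDerived_app_eq _ n

lemma extClassOfCocycle_map_right {Y' : C} (g : Y ⟶ Y') (z : P.cocycles R Y n)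
    (z' : P.cocycles R Y' n) (h : P.cocyclesι R Y' n z' = P.cocyclesι R Y n z ≫ g) :
    (((_root_.Ext R C n).obj (op X)).map g).hom (P.extClassOfCocycle R Y n z) =
      P.extClassOfCocycle R Y' n z' := by
  let Ψ : P.opHom R Y' ⟶ P.opHom R Y := (NatTrans.mapHomologicalComplex
    (NatTrans.rightOp ((linearYoneda R C).map g)) (ComplexShape.down ℕ)).app P.complex
  have h3 := HomologicalComplex.p_opcyclesMap Ψ n
  obtain rfl : ((HomologicalComplex.opcyclesMap Ψ n).unop).hom z = z' :=
    P.cocyclesι_injective Y' n ((congr($(congr(($h3).unop)).hom z)).trans h.symm)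
  have h4 : (NatTrans.leftDerived (NatTrans.rightOp ((linearYoneda R C).map g)) n).app X ≫
      ((P.leftDerivedIsoOpHom R Y n).hom ≫ (P.opHom R Y).homologyι n) =
      ((P.leftDerivedIsoOpHom R Y' n).hom ≫ (P.opHom R Y').homologyι n) ≫
        HomologicalComplex.opcyclesMap Ψ n := by
    rw [P.leftDerivedIsoOpHom_inv_map_right]
    simp only [Category.assoc, Iso.inv_hom_id_assoc]
    rw [HomologicalComplex.homologyι_naturality]
  exact congr($(congr(($h4).unop)).hom z)

variable [HasExt C]

variable (R) in
/-- Both versions of `Ext` agree. -/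
noncomputable def extEquivAbelianExt :
    ((_root_.Ext R C n).obj (op X)).obj Y ≃ₗ[R] Abelian.Ext X Y n :=
  ((P.extClassOfCocycle R Y n).quotKerEquivOfSurjective
    (P.extClassOfCocycle_surjective Y n)).symm.trans
  ((Submodule.quotEquivOfEq _ _ (by
    ext z
    simp only [LinearMap.mem_ker, extClassOfCocycle_eq_zero_iff]
    exact (P.extMk_eq_zero_iff_exists Y n _ (P.d_comp_cocyclesι Y n z)).symm)).trans
  ((P.abelianExtClassOfCocycle R Y n).quotKerEquivOfSurjective
    (P.abelianExtClassOfCocycle_surjective Y n)))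

lemma extEquivAbelianExt_apply (z : P.cocycles R Y n) :
    P.extEquivAbelianExt R Y n (P.extClassOfCocycle R Y n z) =
      P.extMk (P.cocyclesι R Y n z) (n + 1) rfl (P.d_comp_cocyclesι Y n z) := by
  have : ((P.extClassOfCocycle R Y n).quotKerEquivOfSurjective
    (P.extClassOfCocycle_surjective Y n)).symm (P.extClassOfCocycle R Y n z) =
      Submodule.Quotient.mk z := by
    rw [LinearEquiv.symm_apply_eq]; rfl
  rw [extEquivAbelianExt, LinearEquiv.trans_apply, this]
  rfl

lemma extEquivAbelianExt_map_left {X' : C} {P' : ProjectiveResolution X'} {g : X' ⟶ X}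
    (x : ((_root_.Ext R C n).obj (op X)).obj Y) :
    P'.extEquivAbelianExt R Y n ((((_root_.Ext R C n).map g.op).app Y).hom x) =
      (Ext.mk₀ g).comp (P.extEquivAbelianExt R Y n x) (zero_add n) := by
  obtain ⟨z, rfl⟩ := P.extClassOfCocycle_surjective Y n x
  let φ : Hom P' P g :=
    ⟨lift g P' P, by rw [lift_commutes_zero, ChainComplex.single₀_map_f_zero]; rfl⟩
  have hz : P'.complex.d (n + 1) n ≫ φ.hom.f n ≫ P.cocyclesι R Y n z = 0 := by
    simp [← φ.hom.comm_assoc, d_comp_cocyclesι]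
  obtain ⟨z', hz'⟩ := P'.exists_cocyclesι_eq (R := R) Y n _ hz
  rw [P.extClassOfCocycle_map_left Y n φ z z' hz', extEquivAbelianExt_apply,
    extEquivAbelianExt_apply, mk₀_comp_extMk _ _ _ _ φ]
  congr 1

lemma extEquivAbelianExt_map_right {Y' : C} (g : Y ⟶ Y')
    (x : ((_root_.Ext R C n).obj (op X)).obj Y) :
    P.extEquivAbelianExt R Y' n ((((_root_.Ext R C n).obj (op X)).map g).hom x) =
      (P.extEquivAbelianExt R Y n x).comp (Ext.mk₀ g) (add_zero n) := by
  obtain ⟨z, rfl⟩ := P.extClassOfCocycle_surjective Y n x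
  obtain ⟨z', hz'⟩ := P.exists_cocyclesι_eq (R := R) Y' n (P.cocyclesι R Y n z ≫ g)
    (by rw [← Category.assoc, d_comp_cocyclesι, zero_comp])
  rw [P.extClassOfCocycle_map_right Y n g z z' hz', extEquivAbelianExt_apply,
    extEquivAbelianExt_apply, extMk_comp_mk₀]
  congr 1

end
end CategoryTheory.ProjectiveResolution

namespace localCohomology

variable {A : Type u} [CommRing A] (J : Ideal A) (i : ℕ) (M : ModuleCat.{u} A)

/-- The projection from `A ⧸ J ^ t` to `A ⧸ J ^ s` for `s ≤ t`. -/
noncomputable def powTransition {s t : ℕ} (h : s ≤ t) :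
    ModuleCat.of A (A ⧸ J ^ t) ⟶ ModuleCat.of A (A ⧸ J ^ s) :=
  (ringModIdeals (idealPowersDiagram J)).map (homOfLE h).op

/-- The cocone exhibiting local cohomology as a colimit. -/
noncomputable def evalCocone :
    Cocone (diagram (idealPowersDiagram J) i ⋙ (evaluation _ _).obj M) :=
  ((evaluation _ _).obj M).mapCocone (colimit.cocone (diagram (idealPowersDiagram J) i))

/-- The cocone `evalCocone` is a colimit. -/
noncomputable def isColimitEvalCocone : IsColimit (evalCocone J i M) :=
  isColimitOfPreserves ((evaluation _ _).obj M) (colimit.isColimit _)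

instance : PreservesColimit (diagram (idealPowersDiagram J) i ⋙ (evaluation _ _).obj M)
    (forget (ModuleCat.{u} A)) :=
  have : PreservesFilteredColimitsOfSize.{0, 0} (forget (ModuleCat.{u} A)) :=
    preservesFilteredColimitsOfSize_shrink _
  inferInstance

/-- The structure map from `Ext` of `A ⧸ J ^ t` to local cohomology. -/
noncomputable def structureMap (t : ℕ) :
    ((_root_.Ext A (ModuleCat.{u} A) i).obj (op (ModuleCat.of A (A ⧸ J ^ t)))).obj M →ₗ[A]
      (localCohomology J i).obj M :=
  ((evalCocone J i M).ι.app (op (op t))).hom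

/-- The isomorphism between both versions of `Ext` of `A ⧸ J ^ t`. -/
noncomputable def extPowEquiv (t : ℕ) :
    ((_root_.Ext A (ModuleCat.{u} A) i).obj (op (ModuleCat.of A (A ⧸ J ^ t)))).obj M ≃ₗ[A]
      Abelian.Ext (ModuleCat.of A (A ⧸ J ^ t)) M i :=
  (projectiveResolution (ModuleCat.of A (A ⧸ J ^ t))).extEquivAbelianExt A M i

/-- The structure map from the module of extensions of `A ⧸ J ^ t` to local cohomology. -/
noncomputable def ofExt (t : ℕ) :
    Abelian.Ext (ModuleCat.of A (A ⧸ J ^ t)) M i →ₗ[A] (localCohomology J i).obj M :=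
  structureMap J i M t ∘ₗ (extPowEquiv J i M t).symm.toLinearMap

lemma ofExt_extPowEquiv (t : ℕ)
    (x : ((_root_.Ext A (ModuleCat.{u} A) i).obj (op (ModuleCat.of A (A ⧸ J ^ t)))).obj M) :
    ofExt J i M t (extPowEquiv J i M t x) = structureMap J i M t x :=
  congrArg (structureMap J i M t) ((extPowEquiv J i M t).symm_apply_apply x)

lemma exists_ofExt_eq (x : (localCohomology J i).obj M) : ∃ t α, ofExt J i M t α = x := by
  obtain ⟨⟨⟨t⟩⟩, y, hy⟩ := Concrete.isColimit_exists_rep _ (isColimitEvalCocone J i M) x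
  exact ⟨t, extPowEquiv J i M t y, (ofExt_extPowEquiv J i M t y).trans hy⟩

lemma extPowEquiv_map_left {s t : ℕ} (h : s ≤ t)
    (x : ((_root_.Ext A (ModuleCat.{u} A) i).obj (op (ModuleCat.of A (A ⧸ J ^ s)))).obj M) :
    extPowEquiv J i M t ((((_root_.Ext A (ModuleCat.{u} A) i).map (powTransition J h).op).app M).hom
      x) = (Ext.mk₀ (powTransition J h)).comp (extPowEquiv J i M s x) (zero_add i) :=
  ProjectiveResolution.extEquivAbelianExt_map_left _ _ _ _

lemma ofExt_powTransition_comp {s t : ℕ} (h : s ≤ t)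
    (α : Abelian.Ext (ModuleCat.of A (A ⧸ J ^ s)) M i) :
    ofExt J i M t ((Ext.mk₀ (powTransition J h)).comp α (zero_add i)) = ofExt J i M s α := by
  obtain ⟨x, rfl⟩ := (extPowEquiv J i M s).surjective α
  rw [← extPowEquiv_map_left, ofExt_extPowEquiv, ofExt_extPowEquiv]
  have h1 := (evalCocone J i M).w (homOfLE h).op.op
  exact congr($(h1).hom x)

lemma exists_powTransition_comp_eq_zero {s : ℕ}
    (α : Abelian.Ext (ModuleCat.of A (A ⧸ J ^ s)) M i) (hα : ofExt J i M s α = 0) :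
    ∃ t, ∃ h : s ≤ t, (Ext.mk₀ (powTransition J h)).comp α (zero_add i) = 0 := by
  obtain ⟨x, rfl⟩ := (extPowEquiv J i M s).surjective α
  rw [ofExt_extPowEquiv] at hα
  obtain ⟨⟨⟨t⟩⟩, f, g, hfg⟩ := (Concrete.isColimit_rep_eq_iff_exists _
    (isColimitEvalCocone J i M) (i := op (op s)) (j := op (op s)) x 0).1
    (hα.trans (map_zero _).symm)
  refine ⟨t, leOfHom f.unop.unop, ?_⟩
  rw [← extPowEquiv_map_left, LinearEquiv.map_eq_zero_iff]
  exact hfg.trans (map_zero _)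

lemma map_ofExt {M M' : ModuleCat.{u} A} (f : M ⟶ M') (t : ℕ)
    (α : Abelian.Ext (ModuleCat.of A (A ⧸ J ^ t)) M i) :
    (localCohomology J i).map f (ofExt J i M t α) =
      ofExt J i M' t (α.comp (Ext.mk₀ f) (add_zero i)) := by
  obtain ⟨x, rfl⟩ := (extPowEquiv J i M t).surjective α
  have h : extPowEquiv J i M' t
      ((((_root_.Ext A (ModuleCat.{u} A) i).obj (op (ModuleCat.of A (A ⧸ J ^ t)))).map f).hom x) =
        (extPowEquiv J i M t x).comp (Ext.mk₀ f) (add_zero i) :=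
    ProjectiveResolution.extEquivAbelianExt_map_right _ _ _ _ _
  rw [← h, ofExt_extPowEquiv, ofExt_extPowEquiv]
  have h2 := ((colimit.cocone (diagram (idealPowersDiagram J) i)).ι.app (op (op t))).naturality f
  exact congr($(h2).hom x).symm

end localCohomology

namespace localCohomology

variable {A : Type u} [CommRing A] (J : Ideal A) (i : ℕ)

lemma exists_linearMap_ofExt_eq {M X : ModuleCat.{u} A}
    (g : ∀ t, Abelian.Ext (ModuleCat.of A (A ⧸ J ^ t)) M i →ₗ[A] X)
    (hg : ∀ {s t : ℕ} (h : s ≤ t) (α : Abelian.Ext (ModuleCat.of A (A ⧸ J ^ s)) M i),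
      g t ((Ext.mk₀ (powTransition J h)).comp α (zero_add i)) = g s α) :
    ∃ f : (localCohomology J i).obj M →ₗ[A] X, ∀ t α, f (ofExt J i M t α) = g t α := by
  let c : Cocone (diagram (idealPowersDiagram J) i ⋙ (evaluation _ _).obj M) :=
    { pt := X
      ι :=
        { app t := ModuleCat.ofHom (g t.unop.unop ∘ₗ (extPowEquiv J i M t.unop.unop).toLinearMap)
          naturality s t f := by
            ext x
            have h := (congrArg (g t.unop.unop)
              (extPowEquiv_map_left J i M (leOfHom f.unop.unop) x)).trans (hg _ _)
            exact h } }
  refine ⟨((isColimitEvalCocone J i M).desc c).hom, fun t α ↦ ?_⟩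
  obtain ⟨x, rfl⟩ := (extPowEquiv J i M t).surjective α
  rw [ofExt_extPowEquiv]
  exact congr($((isColimitEvalCocone J i M).fac c (op (op t))).hom x)

variable {S : ShortComplex (ModuleCat.{u} A)} (hS : S.ShortExact)

lemma exists_connectingMap : ∃ f : (localCohomology J i).obj S.X₃ →ₗ[A]
    (localCohomology J (i + 1)).obj S.X₁, ∀ t α, f (ofExt J i S.X₃ t α) =
      ofExt J (i + 1) S.X₁ t (α.comp hS.extClass rfl) := by
  refine exists_linearMap_ofExt_eq J i
    (fun t ↦ ofExt J (i + 1) S.X₁ t ∘ₗ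
      { toFun α := α.comp hS.extClass rfl
        map_add' := by simp
        map_smul' := by simp }) ?_
  intro s t h α
  simp only [LinearMap.comp_apply, LinearMap.coe_mk, AddHom.coe_mk]
  rw [Ext.comp_assoc _ _ _ _ rfl (by omega), ofExt_powTransition_comp]

/-- The connecting map in the long exact sequence of local cohomology. -/
noncomputable def connectingMap :
    (localCohomology J i).obj S.X₃ →ₗ[A] (localCohomology J (i + 1)).obj S.X₁ :=
  (exists_connectingMap J i hS).choose

lemma connectingMap_ofExt (t α) : connectingMap J i hS (ofExt J i S.X₃ t α) =
    ofExt J (i + 1) S.X₁ t (α.comp hS.extClass rfl) :=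
  (exists_connectingMap J i hS).choose_spec t α

lemma ker_map_f_eq_range_connectingMap :
    LinearMap.ker ((localCohomology J (i + 1)).map S.f).hom =
      LinearMap.range (connectingMap J i hS) := by
  ext x
  constructor
  · intro hx
    obtain ⟨s, α, rfl⟩ := exists_ofExt_eq J (i + 1) S.X₁ x
    obtain ⟨t, h, ht⟩ := exists_powTransition_comp_eq_zero J _ _ _
      ((map_ofExt J _ _ _ _).symm.trans hx)
    rw [← Ext.comp_assoc _ _ _ (zero_add (i + 1)) (add_zero (i + 1)) (by omega)] at ht
    obtain ⟨β, hβ⟩ := Ext.covariant_sequence_exact₁ _ hS _ ht rfl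
    exact ⟨ofExt J i S.X₃ t β, by rw [connectingMap_ofExt, hβ, ofExt_powTransition_comp]⟩
  · rintro ⟨y, rfl⟩
    obtain ⟨s, α, rfl⟩ := exists_ofExt_eq J i S.X₃ y
    rw [connectingMap_ofExt]
    refine (map_ofExt J _ _ _ _).trans ?_
    rw [Ext.comp_assoc _ _ _ _ (add_zero 1) (by omega), hS.extClass_comp, Ext.comp_zero, map_zero]

lemma connectingMap_injective
    (h : ∀ t, Subsingleton (Abelian.Ext (ModuleCat.of A (A ⧸ J ^ t)) S.X₂ i)) :
    Function.Injective (connectingMap J i hS) := by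
  refine (injective_iff_map_eq_zero _).2 fun x hx ↦ ?_
  obtain ⟨s, α, rfl⟩ := exists_ofExt_eq J i S.X₃ x
  rw [connectingMap_ofExt] at hx
  obtain ⟨t, ht, hα⟩ := exists_powTransition_comp_eq_zero J _ _ _ hx
  rw [← Ext.comp_assoc _ _ _ (zero_add i) rfl (by omega)] at hα
  obtain ⟨β, hβ⟩ := Ext.covariant_sequence_exact₃ _ hS _ rfl hα
  rw [← ofExt_powTransition_comp J i _ ht, ← hβ, Subsingleton.elim β 0, Ext.zero_comp, map_zero]

lemma exact_map_map {S : ShortComplex (ModuleCat.{u} A)} (hS : S.ShortExact) :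
    Function.Exact ((localCohomology J i).map S.f) ((localCohomology J i).map S.g) := by
  intro x
  constructor
  · intro hx
    obtain ⟨s, α, rfl⟩ := exists_ofExt_eq J i S.X₂ x
    rw [map_ofExt] at hx
    obtain ⟨t, h, ht⟩ := exists_powTransition_comp_eq_zero J _ _ _ hx
    rw [← Ext.comp_assoc _ _ _ (zero_add i) (add_zero i) (by omega)] at ht
    obtain ⟨β, hβ⟩ := Ext.covariant_sequence_exact₂ _ hS _ ht
    exact ⟨ofExt J i S.X₁ t β, by rw [map_ofExt, hβ, ofExt_powTransition_comp]⟩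
  · rintro ⟨y, rfl⟩
    obtain ⟨s, α, rfl⟩ := exists_ofExt_eq J i S.X₁ y
    rw [map_ofExt, map_ofExt, Ext.comp_assoc _ _ _ (add_zero i) (add_zero 0) (by omega),
      Ext.mk₀_comp_mk₀, S.zero, Ext.mk₀_zero, Ext.comp_zero, map_zero]

lemma map_g_surjective {S : ShortComplex (ModuleCat.{u} A)} (hS : S.ShortExact)
    (h : ∀ t, Subsingleton (Abelian.Ext (ModuleCat.of A (A ⧸ J ^ t)) S.X₁ (i + 1))) :
    Function.Surjective ((localCohomology J i).map S.g) := by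
  intro x
  obtain ⟨t, α, rfl⟩ := exists_ofExt_eq J i S.X₃ x
  obtain ⟨β, hβ⟩ := Ext.covariant_sequence_exact₃ _ hS α rfl (Subsingleton.elim _ _)
  exact ⟨ofExt J i S.X₂ t β, by rw [map_ofExt, hβ]⟩

lemma map_add_hom {M M' : ModuleCat.{u} A} (f g : M ⟶ M') (x : (localCohomology J i).obj M) :
    (localCohomology J i).map (f + g) x =
      (localCohomology J i).map f x + (localCohomology J i).map g x := by
  obtain ⟨t, α, rfl⟩ := exists_ofExt_eq J i M x
  rw [map_ofExt, map_ofExt, map_ofExt, Ext.mk₀_add, Ext.comp_add, map_add]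

lemma map_smul_hom {M M' : ModuleCat.{u} A} (r : A) (f : M ⟶ M')
    (x : (localCohomology J i).obj M) :
    (localCohomology J i).map (r • f) x = r • (localCohomology J i).map f x := by
  obtain ⟨t, α, rfl⟩ := exists_ofExt_eq J i M x
  rw [map_ofExt, map_ofExt, Ext.mk₀_smul, Ext.comp_smul, map_smul]

/-- Local cohomology as a linear map on homomorphisms. -/
noncomputable def mapLinear (M M' : ModuleCat.{u} A) :
    (M →ₗ[A] M') →ₗ[A] ((localCohomology J i).obj M →ₗ[A] (localCohomology J i).obj M') where
  toFun f := ((localCohomology J i).map (ModuleCat.ofHom f)).hom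
  map_add' f g := LinearMap.ext (map_add_hom J i (ModuleCat.ofHom f) (ModuleCat.ofHom g))
  map_smul' r f := LinearMap.ext (map_smul_hom J i r (ModuleCat.ofHom f))

end localCohomology

namespace localCohomology

section

variable {A : Type u} [CommRing A] (J : Ideal A) (n : ℕ)

/-- The natural map from the tensor product with the local cohomology of the ring. -/
noncomputable def tensorMap (M : ModuleCat.{u} A) :
    (localCohomology J n).obj (ModuleCat.of A A) ⊗[A] M →ₗ[A] (localCohomology J n).obj M :=
  TensorProduct.lift ((mapLinear J n (ModuleCat.of A A) M) ∘ₗ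
    (LinearMap.ringLmapEquivSelf A A M).symm.toLinearMap).flip

lemma tensorMap_tmul (M : ModuleCat.{u} A) (a : (localCohomology J n).obj (ModuleCat.of A A))
    (m : M) : tensorMap J n M (a ⊗ₜ m) =
      (localCohomology J n).map (ModuleCat.ofHom (LinearMap.toSpanSingleton A M m)) a :=
  rfl

lemma tensorMap_lTensor {M M' : ModuleCat.{u} A} (f : M ⟶ M')
    (z : (localCohomology J n).obj (ModuleCat.of A A) ⊗[A] M) :
    tensorMap J n M' (f.hom.lTensor _ z) = (localCohomology J n).map f (tensorMap J n M z) := by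
  induction z with
  | zero => simp
  | add x y hx hy => simp only [map_add, hx, hy]
  | tmul a m =>
    rw [LinearMap.lTensor_tmul, tensorMap_tmul, tensorMap_tmul, ← ModuleCat.comp_apply,
      ← Functor.map_comp, ← ModuleCat.ofHom_hom f, ← ModuleCat.ofHom_comp]
    congr 4
    ext
    simp

lemma tensorMap_self (z : (localCohomology J n).obj (ModuleCat.of A A) ⊗[A] A) :
    tensorMap J n (ModuleCat.of A A) z = TensorProduct.rid A _ z := by
  induction z with
  | zero => simp
  | add x y hx hy => simp only [map_add, hx, hy]
  | tmul a r =>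
    have h : ModuleCat.ofHom (LinearMap.toSpanSingleton A A r) = r • 𝟙 (ModuleCat.of A A) := by
      ext; simp
    refine (tensorMap_tmul J n (ModuleCat.of A A) a r).trans ?_
    rw [h, map_smul_hom, CategoryTheory.Functor.map_id, TensorProduct.rid_tmul, ModuleCat.id_apply]

lemma tensorMap_finsupp_injective (ι : Type u) :
    Function.Injective (tensorMap J n (ModuleCat.of A (ι →₀ A))) := by
  classical
  refine (injective_iff_map_eq_zero _).2 fun z hz ↦ ?_
  rw [← LinearEquiv.map_eq_zero_iff (TensorProduct.finsuppScalarRight A A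
    ((localCohomology J n).obj (ModuleCat.of A A)) ι)]
  ext s
  have h1 : TensorProduct.finsuppScalarRight A A
      ((localCohomology J n).obj (ModuleCat.of A A)) ι z s =
        TensorProduct.rid A _ ((Finsupp.lapply s : (ι →₀ A) →ₗ[A] A).lTensor _ z) := by
    clear hz
    induction z with
    | zero => simp
    | add x y hx hy => simp only [map_add, Finsupp.add_apply, hx, hy]
    | tmul a m => simp
  have h2 := tensorMap_lTensor J n
    (ModuleCat.ofHom (Finsupp.lapply s : (ι →₀ A) →ₗ[A] A)) z
  rw [hz, map_zero, ModuleCat.hom_ofHom] at h2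
  rw [h1, ← tensorMap_self]
  exact h2

lemma tensorMap_finsupp_surjective [IsNoetherianRing A] (ι : Type u) :
    Function.Surjective (tensorMap J n (ModuleCat.of A (ι →₀ A))) := by
  intro y
  obtain ⟨t, α, rfl⟩ := exists_ofExt_eq J n _ y
  obtain ⟨S, hS⟩ := ModuleCat.ext_finsupp_eq_sum _ ι n α
  rw [← hS, map_sum, ← LinearMap.mem_range]
  refine Submodule.sum_mem _ fun s _ ↦ ?_
  refine ⟨(localCohomology J n).map (ModuleCat.ofHom (Finsupp.lapply s : (ι →₀ A) →ₗ[A] A))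
    (ofExt J n _ t α) ⊗ₜ Finsupp.single s 1, ?_⟩
  rw [← map_ofExt, tensorMap_tmul, ← ModuleCat.comp_apply, ← Functor.map_comp,
    ← ModuleCat.ofHom_comp]
  congr 5
  ext
  simp

variable [IsNoetherianRing A]

lemma tensorMap_surjective (hJ : ∀ t (M : ModuleCat.{u} A),
    Subsingleton (Abelian.Ext (ModuleCat.of A (A ⧸ J ^ t)) M (n + 1))) (M : ModuleCat.{u} A) :
    Function.Surjective (tensorMap J n M) := by
  let π : (M →₀ A) →ₗ[A] M := Finsupp.linearCombination A id
  have hπ : Function.Surjective π := Finsupp.linearCombination_id_surjective A M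
  intro y
  obtain ⟨x, rfl⟩ := map_g_surjective J n (LinearMap.shortExact_shortComplexKer hπ)
    (fun t ↦ hJ t _) y
  obtain ⟨z, rfl⟩ := tensorMap_finsupp_surjective J n M x
  exact ⟨_, tensorMap_lTensor J n (ModuleCat.ofHom π) z⟩

lemma tensorMap_injective (hJ : ∀ t (M : ModuleCat.{u} A),
    Subsingleton (Abelian.Ext (ModuleCat.of A (A ⧸ J ^ t)) M (n + 1))) (M : ModuleCat.{u} A) :
    Function.Injective (tensorMap J n M) := by
  let π : (M →₀ A) →ₗ[A] M := Finsupp.linearCombination A id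
  have hπ : Function.Surjective π := Finsupp.linearCombination_id_surjective A M
  have hS := LinearMap.shortExact_shortComplexKer hπ
  refine (injective_iff_map_eq_zero _).2 fun z hz ↦ ?_
  obtain ⟨w, rfl⟩ := LinearMap.lTensor_surjective _ hπ z
  have h1 := (tensorMap_lTensor J n (ModuleCat.ofHom π) w).symm.trans hz
  obtain ⟨y, hy⟩ := (exact_map_map J n hS _).1 h1
  obtain ⟨v, rfl⟩ := tensorMap_surjective J n hJ _ y
  rw [← tensorMap_lTensor] at hy
  rw [← tensorMap_finsupp_injective J n M hy, ← LinearMap.comp_apply, ← LinearMap.lTensor_comp]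
  have h2 : π ∘ₗ (LinearMap.shortComplexKer π).f.hom = 0 := by
    ext x
    exact x.2
  exact congr($(congrArg (LinearMap.lTensor _) h2) v).trans (by simp)

end

end localCohomology

section

variable {C D : Type*} [Category* C] [Abelian C] [Category* D] [Abelian D]

namespace CategoryTheory.ShortComplex

variable (S : ShortComplex C) (F : C ⥤ D) [F.Additive]

lemma map_f_comp_map_pOpcycles : (S.map F).f ≫ F.map S.pOpcycles = 0 :=
  (F.map_comp _ _).symm.trans ((congrArg F.map S.f_pOpcycles).trans (F.map_zero _ _))

variable [PreservesFiniteColimits F]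

/-- A right exact functor preserves opcycles. -/
noncomputable def isColimitMapOpcycles :
    IsColimit (CokernelCofork.ofπ (f := (S.map F).f) (F.map S.pOpcycles)
      (S.map_f_comp_map_pOpcycles F)) :=
  CokernelCofork.mapIsColimit _ S.opcyclesIsCokernel F

lemma isColimitMapOpcycles_desc :
    (S.isColimitMapOpcycles F).desc (CokernelCofork.ofπ _ (S.map F).zero) =
      F.map S.fromOpcycles := by
  refine Cofork.IsColimit.hom_ext (S.isColimitMapOpcycles F) ?_
  refine ((S.isColimitMapOpcycles F).fac _ WalkingParallelPair.one).trans ?_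
  exact (congrArg F.map S.p_fromOpcycles).symm.trans (F.map_comp _ _)

/-- The homology of the image of a short complex under a right exact functor. -/
noncomputable def homologyMapIsoKernel :
    (S.map F).homology ≅ kernel (F.map S.fromOpcycles) :=
  ShortComplex.RightHomologyData.homologyIso
    { Q := F.obj S.opcycles
      H := kernel ((S.isColimitMapOpcycles F).desc (CokernelCofork.ofπ _ (S.map F).zero))
      p := F.map S.pOpcycles
      ι := kernel.ι _
      wp := S.map_f_comp_map_pOpcycles F
      hp := S.isColimitMapOpcycles F
      wι := kernel.condition _
      hι := kernelIsKernel _ } ≪≫ kernelIsoOfEq (S.isColimitMapOpcycles_desc F)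

end CategoryTheory.ShortComplex

namespace CategoryTheory.ProjectiveResolution

variable {X : C} (P : ProjectiveResolution X)

/-- The short complex `P₂ ⟶ P₁ ⟶ P₀` of a projective resolution. -/
noncomputable abbrev scOne : ShortComplex C :=
  ShortComplex.mk _ _ (P.complex.d_comp_d 2 1 0)

/-- The augmentation of a projective resolution. -/
noncomputable def augmentation : P.complex.X 0 ⟶ X := P.π.f 0

lemma d_augmentation : P.complex.d 1 0 ≫ P.augmentation = 0 := P.complex_d_comp_π_f_zero

/-- The short exact sequence given by the first syzygy of a projective resolution. -/
noncomputable abbrev syzygySequence : ShortComplex C :=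
  ShortComplex.mk P.scOne.fromOpcycles P.augmentation (by
    rw [← cancel_epi P.scOne.pOpcycles, ShortComplex.p_fromOpcycles_assoc, comp_zero]
    exact P.d_augmentation)

lemma shortExact_syzygySequence : P.syzygySequence.ShortExact where
  exact := by
    let φ : ShortComplex.mk _ _ P.d_augmentation ⟶ P.syzygySequence :=
      { τ₁ := P.scOne.pOpcycles, τ₂ := 𝟙 _, τ₃ := 𝟙 _ }
    have : Epi φ.τ₁ := inferInstanceAs (Epi P.scOne.pOpcycles)
    have : IsIso φ.τ₂ := inferInstanceAs (IsIso (𝟙 _))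
    have : Mono φ.τ₃ := inferInstanceAs (Mono (𝟙 _))
    exact (ShortComplex.exact_iff_of_epi_of_isIso_of_mono φ).1 P.exact₀
  mono_f := (P.exact_succ 0).mono_fromOpcycles
  epi_g := inferInstanceAs (Epi (P.π.f 0))

/-- The first derived functor of a right exact functor in terms of the first syzygy. -/
noncomputable def leftDerivedOneIso [EnoughProjectives C] (F : C ⥤ D) [F.Additive]
    [PreservesFiniteColimits F] :
    (F.leftDerived 1).obj X ≅ kernel (F.map P.syzygySequence.f) :=
  P.isoLeftDerivedObj F 1 ≪≫
    ShortComplex.homologyMapIso (((F.mapHomologicalComplex _).obj P.complex).isoSc' 2 1 0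
      (by simp) (by simp)) ≪≫ P.scOne.homologyMapIsoKernel F

/-- The first derived functor of a right exact functor in terms of an isomorphic functor. -/
noncomputable def leftDerivedOneIsoOfIso [EnoughProjectives C] {F G : C ⥤ D} [F.Additive]
    [PreservesFiniteColimits F] (e : F ≅ G) :
    (F.leftDerived 1).obj X ≅ kernel (G.map P.syzygySequence.f) :=
  P.leftDerivedOneIso F ≪≫ kernel.mapIso _ _ (e.app _) (e.app _) (e.hom.naturality _)

end CategoryTheory.ProjectiveResolution

end

namespace localCohomology

variable {A : Type u} [CommRing A] (J : Ideal A)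

/-- Local cohomology in terms of the first syzygy. -/
lemma nonempty_iso_kernel (d : ℕ) {S : ShortComplex (ModuleCat.{u} A)} (hS : S.ShortExact)
    (h : ∀ t, Subsingleton (Abelian.Ext (ModuleCat.of A (A ⧸ J ^ t)) S.X₂ d)) :
    Nonempty ((localCohomology J d).obj S.X₃ ≅
      kernel ((localCohomology J (d + 1)).map S.f)) :=
  ⟨(((LinearEquiv.ofInjective _ (connectingMap_injective J d hS h)).trans
    (LinearEquiv.ofEq _ _ (ker_map_f_eq_range_connectingMap J d hS).symm)).toModuleIso :
      (localCohomology J d).obj S.X₃ ≅ ModuleCat.of A _) ≪≫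
    (ModuleCat.kernelIsoKer _).symm⟩

/-- The natural isomorphism `tensorMap` of a vanishing local cohomology functor. -/
noncomputable def tensorIso [IsNoetherianRing A] (n : ℕ)
    (hJ : ∀ t (M : ModuleCat.{u} A),
      Subsingleton (Abelian.Ext (ModuleCat.of A (A ⧸ J ^ t)) M (n + 1))) :
    (MonoidalCategory.tensoringLeft (ModuleCat.{u} A)).obj
      ((localCohomology J n).obj (ModuleCat.of A A)) ≅ localCohomology J n :=
  NatIso.ofComponents (fun M ↦ (LinearEquiv.ofBijective (tensorMap J n M)
      ⟨tensorMap_injective J n hJ M, tensorMap_surjective J n hJ M⟩).toModuleIso)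
    fun f ↦ ModuleCat.hom_ext (LinearMap.ext fun z ↦ tensorMap_lTensor J n f z)

end localCohomology

end

/-- For a Noetherian regular local ring `(A, 𝔪)` of Krull dimension `d + 1` and any `A`-module
`N`, there is an isomorphism `Tor_1^A(H^{d+1}_𝔪(A), N) ≅ H^d_𝔪(N)`. -/
theorem tor_one_topLocalCohomology_iso_localCohomology (A : Type u) [CommRing A]
    [IsNoetherianRing A] [IsLocalRing A] (hreg : IsRegularLocal A) (d : ℕ)
    (hdim : ringKrullDim A = ((d + 1 : ℕ) : WithBot ℕ∞)) (N : ModuleCat.{u} A) :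
    Nonempty
      ((((Tor (ModuleCat.{u} A) 1).obj
          ((localCohomology (IsLocalRing.maximalIdeal A) (d + 1)).obj
            (ModuleCat.of A A))).obj N) ≅
        (localCohomology (IsLocalRing.maximalIdeal A) d).obj N) := by
  obtain ⟨-, s, hs, hcard⟩ := hreg
  rw [hdim] at hcard
  have hcard' : s.card = d + 1 := by exact_mod_cast hcard
  obtain ⟨-, rs, hlen, hrs, reg⟩ := IsLocalRing.isDomain_and_exists_isRegular (d + 1) s hs hcard'
    hdim.ge
  have hpd (t : ℕ) : HasProjectiveDimensionLE
      (ModuleCat.of A (A ⧸ IsLocalRing.maximalIdeal A ^ t)) (d + 1) :=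
    ModuleCat.hasProjectiveDimensionLE_of_isFiniteLength
      (hlen ▸ ModuleCat.hasProjectiveDimensionLE_residue hrs reg) _
      (IsLocalRing.isFiniteLength_quotient_maximalIdeal_pow t)
  let P := projectiveResolution N
  have : Module.Projective A (P.complex.X 0) := (IsProjective.iff_projective _).2 (P.projective 0)
  obtain ⟨e₁⟩ := localCohomology.nonempty_iso_kernel (IsLocalRing.maximalIdeal A) d
    P.shortExact_syzygySequence fun t ↦ ModuleCat.subsingleton_ext_of_projective _ d
      (ModuleCat.subsingleton_ext_quotient_pow_self hrs reg t (by omega)) (P.complex.X 0)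
  let T := localCohomology.tensorIso (IsLocalRing.maximalIdeal A) (d + 1)
    (fun t M ↦ (hpd t).subsingleton _ _ _ le_rfl _)
  exact ⟨P.leftDerivedOneIsoOfIso T ≪≫ e₁.symm⟩
end

section
/- Let (R,𝔪,k) be a complete Noetherian normal local domain of Krull dimension d whose residue field k is perfect of characteristic p > 0, and let Q ⊆ R be a height-one prime ideal such that both R and R/Q have mixed characteristic. Then there exists an injective local ring homomorphism ι : A → R, where A = W(k)[[x_1,…,x_{d−1}]] is the formal power series ring in d−1 variables over the ring of p-typical Witt vectors of k, such that: (1) R is a finitely generated A-module; (2) the preimage ι^{−1}(Q) equals the principal prime ideal (x_1) of A; and (3) the induced homomorphism from the localization of A at the prime (x_1) to the localization of R at Q is essentially étale, i.e., it is flat and formally unramified. -/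
/-- A local ring has mixed characteristic if it has characteristic zero and its residue field
has characteristic `p > 0`. -/
def MixedCharLocal (R : Type*) [CommRing R] [IsLocalRing R] : Prop :=
  CharZero R ∧ ∃ p : ℕ, 0 < p ∧ CharP (IsLocalRing.ResidueField R) p

universe u

theorem dvd_of_forall_pow_dvd_mul_pow {B : Type*} [CommRing B] [IsDomain B] [IsNoetherianRing B]
    [IsIntegrallyClosed B] {a b c : B} (hc : c ≠ 0) (hb : b ≠ 0) (h : ∀ n, b ^ n ∣ c * a ^ n) :
    b ∣ a := by
  let K := FractionRing B
  have hb' : algebraMap B K b ≠ 0 := by simpa using hb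
  have : IsAlmostIntegral B (algebraMap B K a / algebraMap B K b) := by
    refine ⟨c, mem_nonZeroDivisors_of_ne_zero hc, fun n ↦ ?_⟩
    obtain ⟨q, hq⟩ := h n
    refine ⟨q, ?_⟩
    rw [Algebra.smul_def, div_pow, mul_div_assoc', eq_div_iff (pow_ne_zero _ hb')]
    simp only [← map_mul, ← map_pow]
    rw [hq, mul_comm]
  obtain ⟨y, hy⟩ := IsIntegrallyClosed.isIntegral_iff.mp this.isIntegral
  refine ⟨y, IsFractionRing.injective B K ?_⟩
  rw [map_mul, hy, mul_div_cancel₀ _ hb']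

theorem isIntegrallyClosed_of_forall_dvd {B : Type*} [CommRing B] [IsDomain B]
    (H : ∀ a b c : B, c ≠ 0 → b ≠ 0 → (∀ n, b ^ n ∣ c * a ^ n) → b ∣ a) :
    IsIntegrallyClosed B := by
  let K := FractionRing B
  refine (isIntegrallyClosed_iff K).mpr fun {x} hx ↦ ?_
  obtain ⟨a, b, hb, rfl⟩ := IsFractionRing.div_surjective (A := B) x
  have hb0 := nonZeroDivisors.ne_zero hb
  have hb' : algebraMap B K b ≠ 0 := by simpa using hb0
  obtain ⟨c, hc, hcn⟩ := hx.isAlmostIntegral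
  obtain ⟨y, rfl⟩ := H a b c (nonZeroDivisors.ne_zero hc) hb0 fun n ↦ by
    obtain ⟨q, hq⟩ := hcn n
    refine ⟨q, IsFractionRing.injective B K ?_⟩
    rw [Algebra.smul_def, div_pow, mul_div_assoc', eq_div_iff (pow_ne_zero _ hb')] at hq
    simp only [map_mul, map_pow]
    rw [← hq, mul_comm]
  exact ⟨y, by rw [map_mul, mul_div_cancel_left₀ _ hb']⟩

namespace PowerSeries

variable {B : Type*} [CommRing B] [IsDomain B] [IsNoetherianRing B] [IsIntegrallyClosed B]

/-- One step of power series division when the divisor has nonzero constant coefficient. -/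
theorem exists_eq_mul_C_add_X_mul {f g h : B⟦X⟧} (hh : h ≠ 0) (hg : constantCoeff g ≠ 0)
    (H : ∀ n, g ^ n ∣ h * f ^ n) :
    ∃ (c : B) (f' : B⟦X⟧), f = g * C c + X * f' ∧ ∀ n, g ^ n ∣ h * f' ^ n := by
  have hXg : ¬ X ∣ g := by rwa [X_dvd_iff]
  have cancel : ∀ (m n : ℕ) (u : B⟦X⟧), g ^ n ∣ X ^ m * u → g ^ n ∣ u := by
    rintro m n u ⟨q, hq⟩
    obtain ⟨q', rfl⟩ := X_prime.pow_dvd_of_dvd_mul_left m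
      (fun hX ↦ hXg (X_prime.dvd_of_dvd_pow hX)) (Dvd.intro u hq)
    refine ⟨q', mul_left_cancel₀ (pow_ne_zero m X_ne_zero) (hq.trans (by ring))⟩
  obtain ⟨l, h', hh', hl⟩ : ∃ (l : ℕ) (h' : B⟦X⟧), constantCoeff h' ≠ 0 ∧ h = X ^ l * h' := by
    obtain ⟨h', h1, h2⟩ :=
      (FiniteMultiplicity.of_prime_left X_prime hh).exists_eq_pow_mul_and_not_dvd
    exact ⟨_, h', by rwa [X_dvd_iff] at h2, h1⟩
  obtain ⟨c, hc⟩ : constantCoeff g ∣ constantCoeff f := by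
    refine dvd_of_forall_pow_dvd_mul_pow hh' hg fun n ↦ ?_
    have := cancel l n (h' * f ^ n) (by rw [← mul_assoc, ← hl]; exact H n)
    simpa using map_dvd constantCoeff this
  obtain ⟨f', hf'⟩ : X ∣ f - g * C c := by
    rw [X_dvd_iff]; simp [hc]
  refine ⟨c, f', by rw [← hf']; ring, fun n ↦ ?_⟩
  refine cancel n n _ ?_
  have : X ^ n * (h * f' ^ n) = h * (f + -(g * C c)) ^ n := by
    rw [← sub_eq_add_neg, hf']; ring
  rw [this, add_pow, Finset.mul_sum]
  refine Finset.dvd_sum fun i hi ↦ ?_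
  have hi' : i ≤ n := by simpa [Nat.lt_succ_iff] using hi
  obtain ⟨q, hq⟩ := H i
  refine ⟨q * (-C c) ^ (n - i) * (n.choose i), ?_⟩
  rw [← pow_mul_pow_sub g hi', ← mul_assoc, ← mul_assoc, hq, neg_mul_eq_mul_neg, mul_pow]
  ring

theorem dvd_of_forall_pow_dvd_mul_pow_of_constantCoeff_ne_zero {f g h : B⟦X⟧} (hh : h ≠ 0)
    (hg : constantCoeff g ≠ 0) (H : ∀ n, g ^ n ∣ h * f ^ n) : g ∣ f := by
  choose c s hs using fun f : {f : B⟦X⟧ // ∀ n, g ^ n ∣ h * f ^ n} ↦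
    exists_eq_mul_C_add_X_mul hh hg f.2
  let t : {f : B⟦X⟧ // ∀ n, g ^ n ∣ h * f ^ n} → {f : B⟦X⟧ // ∀ n, g ^ n ∣ h * f ^ n} :=
    fun f ↦ ⟨s f, (hs f).2⟩
  let Q : {f : B⟦X⟧ // ∀ n, g ^ n ∣ h * f ^ n} → B⟦X⟧ := fun f ↦ .mk fun n ↦ c (t^[n] f)
  have hQ (f) : Q f = C (c f) + X * Q (t f) := by
    ext n
    cases n <;> simp [Q, coeff_succ_X_mul]
  have key (m : ℕ) : ∀ f, X ^ m ∣ f.1 - g * Q f := by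
    induction m with
    | zero => simp
    | succ m ih =>
      intro f
      have : f.1 - g * Q f = X * ((t f).1 - g * Q (t f)) := by
        rw [hQ f]
        nth_rewrite 1 [(hs f).1]
        ring
      rw [this, pow_succ']
      exact mul_dvd_mul_left X (ih _)
  refine ⟨Q ⟨f, H⟩, sub_eq_zero.mp ?_⟩
  ext n
  exact X_pow_dvd_iff.mp (key (n + 1) ⟨f, H⟩) n n.lt_succ_self

theorem dvd_of_forall_pow_dvd_mul_pow {f g h : B⟦X⟧} (hh : h ≠ 0) (hg : g ≠ 0)
    (H : ∀ n, g ^ n ∣ h * f ^ n) : g ∣ f := by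
  obtain rfl | hf := eq_or_ne f 0
  · exact dvd_zero g
  obtain ⟨g', h1, h2⟩ :=
    (FiniteMultiplicity.of_prime_left X_prime hg).exists_eq_pow_mul_and_not_dvd
  generalize multiplicity X g = k at h1
  obtain ⟨h', h3, h4⟩ :=
    (FiniteMultiplicity.of_prime_left X_prime hh).exists_eq_pow_mul_and_not_dvd
  generalize multiplicity X h = l at h3
  obtain ⟨f', h5, h6⟩ :=
    (FiniteMultiplicity.of_prime_left X_prime hf).exists_eq_pow_mul_and_not_dvd
  generalize multiplicity X f = m at h5
  have hkm : k ≤ m := by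
    have hd : X ^ (k * (l + 1)) ∣ X ^ (l + m * (l + 1)) * (h' * f' ^ (l + 1)) := by
      refine (Dvd.intro (g' ^ (l + 1)) ?_ : X ^ (k * (l + 1)) ∣ g ^ (l + 1)).trans
        ((H (l + 1)).trans (dvd_of_eq ?_))
      · rw [h1]; ring
      · rw [h3, h5]; ring
    have hnd : ¬ X ∣ h' * f' ^ (l + 1) := fun hX ↦
      (X_prime.dvd_or_dvd hX).elim h4 fun hX ↦ h6 (X_prime.dvd_of_dvd_pow hX)
    have := (pow_dvd_pow_iff X_ne_zero X_prime.not_isUnit).mp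
      (X_prime.pow_dvd_of_dvd_mul_right _ hnd hd)
    nlinarith
  obtain ⟨m, rfl⟩ := Nat.exists_eq_add_of_le hkm
  have : g' ∣ X ^ m * f' := by
    refine dvd_of_forall_pow_dvd_mul_pow_of_constantCoeff_ne_zero hh
      (by rwa [X_dvd_iff] at h2) fun n ↦ ?_
    refine (mul_dvd_mul_iff_left (pow_ne_zero (k * n) X_ne_zero)).mp ?_
    convert H n using 1
    · rw [h1]; ring
    · rw [h5]; ring
  rw [h1, h5, pow_add, mul_assoc]
  exact mul_dvd_mul_left _ this

instance isIntegrallyClosed : IsIntegrallyClosed B⟦X⟧ :=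
  isIntegrallyClosed_of_forall_dvd fun _ _ _ hc hb ↦ dvd_of_forall_pow_dvd_mul_pow hc hb

end PowerSeries

instance MvPowerSeries.isIntegrallyClosed_fin {B : Type*} [CommRing B] [IsDomain B]
    [IsNoetherianRing B] [IsIntegrallyClosed B] (n : ℕ) :
    IsIntegrallyClosed (MvPowerSeries (Fin n) B) := by
  induction n with
  | zero => exact .of_equiv (MvPowerSeries.isEmptyEquiv (Fin 0) B).symm.toRingEquiv
  | succ n ih =>
    have : IsDomain (MvPowerSeries (Fin n) B) := {}
    exact .of_equiv (MvPowerSeries.finSuccEquiv B n).symm.toRingEquiv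

theorem Submodule.mem_ideal_smul_top_pi {A ι : Type*} [CommRing A] [Finite ι] {I : Ideal A}
    {x : ι → A} : x ∈ (I • ⊤ : Submodule A (ι → A)) ↔ ∀ i, x i ∈ I := by
  classical
  have := Fintype.ofFinite ι
  constructor
  · intro h i
    have h2 : x i ∈ (I • ⊤ : Submodule A (ι → A)).map (LinearMap.proj i) := ⟨x, h, rfl⟩
    rw [Submodule.map_smul''] at h2
    have h3 : x i ∈ (I • ⊤ : Submodule A A) := Submodule.smul_mono le_rfl le_top h2
    simpa using h3
  · intro h
    rw [pi_eq_sum_univ x]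
    exact sum_mem fun i _ ↦ Submodule.smul_mem_smul (h i) trivial

instance IsPrecomplete.pi_of_finite {A ι : Type*} [CommRing A] [Finite ι] (I : Ideal A)
    [IsPrecomplete I A] : IsPrecomplete I (ι → A) where
  prec' f hf := by
    have key (i : ι) : ∃ L : A, ∀ n, f n i ≡ L [SMOD (I ^ n • ⊤ : Submodule A A)] := by
      refine IsPrecomplete.prec ‹_› fun {m n} hmn ↦ ?_
      have := hf hmn
      rw [SModEq.sub_mem, Submodule.mem_ideal_smul_top_pi] at this
      rw [SModEq.sub_mem]
      simpa using this i
    choose L hL using key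
    refine ⟨L, fun n ↦ ?_⟩
    rw [SModEq.sub_mem, Submodule.mem_ideal_smul_top_pi]
    intro i
    have := hL i n
    rw [SModEq.sub_mem] at this
    simpa using this

theorem Module.Finite.of_finite_quotient_smul_top {A M : Type*} [CommRing A] [AddCommGroup M]
    [Module A M] (I : Ideal A) [IsPrecomplete I A] [IsHausdorff I M]
    [Module.Finite A (M ⧸ (I • ⊤ : Submodule A M))] : Module.Finite A M := by
  obtain ⟨n, f, hf⟩ := Module.Finite.exists_fin' A (M ⧸ (I • ⊤ : Submodule A M))
  obtain ⟨g, hg⟩ := Module.projective_lifting_property (Submodule.mkQ (I • ⊤ : Submodule A M)) f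
    (Submodule.mkQ_surjective _)
  refine Module.Finite.of_surjective g
    (surjective_of_mkQ_comp_surjective (I := I) (by rwa [hg]))

theorem IsFiniteLength.finite_of_residue_surjective {W R : Type*} [CommRing W] [CommRing R]
    [IsLocalRing R] [Algebra W R]
    (hsurj : Function.Surjective ((IsLocalRing.residue R).comp (algebraMap W R)))
    {M : Type*} [AddCommGroup M] [Module R M] (hM : IsFiniteLength R M) :
    ∀ [Module W M] [IsScalarTower W R M], Module.Finite W M := by
  induction hM with
  | of_subsingleton => intros; infer_instance
  | @of_simple_quotient M _ _ N hs _ ih =>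
    intro _ _
    have := IsSimpleModule.nontrivial R (M ⧸ N)
    have h1 : Module.Finite W (N.restrictScalars W) := ih
    have h2 : Module.Finite W (M ⧸ N) := by
      obtain ⟨m, hm⟩ := exists_ne (0 : M ⧸ N)
      refine Module.Finite.of_surjective (LinearMap.toSpanSingleton W (M ⧸ N) m) fun y ↦ ?_
      obtain ⟨r, rfl⟩ := IsSimpleModule.toSpanSingleton_surjective R hm y
      obtain ⟨w, hw⟩ := hsurj (IsLocalRing.residue R r)
      refine ⟨w, ?_⟩
      have hmem : r - algebraMap W R w ∈ Module.annihilator R (M ⧸ N) := by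
        have hmax : (Module.annihilator R (M ⧸ N)).IsMaximal := IsSimpleModule.annihilator_isMaximal
        rw [IsLocalRing.eq_maximalIdeal hmax, ← Ideal.Quotient.eq_zero_iff_mem, map_sub, sub_eq_zero]
        exact hw.symm
      have := Module.mem_annihilator.1 hmem m
      rw [sub_smul, sub_eq_zero, algebraMap_smul] at this
      exact this.symm
    have h3 : Module.Finite W (M ⧸ N.restrictScalars W) :=
      .equiv (Submodule.Quotient.restrictScalarsEquiv W N).symm
    exact Module.Finite.of_submodule_quotient (N.restrictScalars W)

theorem module_finite_mvPowerSeries {W R σ : Type*} [CommRing W] [CommRing R] [IsNoetherianRing R]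
    [IsLocalRing R] [Finite σ] [Algebra W R] (π : W) [IsPrecomplete (Ideal.span {π}) W]
    (hsurj : Function.Surjective ((IsLocalRing.residue R).comp (algebraMap W R)))
    [Algebra (MvPowerSeries σ W) R] [IsScalarTower W (MvPowerSeries σ W) R]
    (h : IsLocalRing.maximalIdeal R ∈ (Ideal.span (insert (algebraMap W R π)
      (Set.range fun i ↦ algebraMap (MvPowerSeries σ W) R (MvPowerSeries.X i)))).minimalPrimes) :
    Module.Finite (MvPowerSeries σ W) R := by
  set A := MvPowerSeries σ W
  set J : Ideal A := .span (.range MvPowerSeries.X)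
  set J' := J.map (algebraMap A R) with hJ'
  have hspan : Ideal.span (insert (algebraMap W R π)
      (Set.range fun i ↦ algebraMap A R (MvPowerSeries.X i))) =
      (Ideal.span {π}).map (algebraMap W R) ⊔ J' := by
    rw [Ideal.span_insert, Ideal.map_span, Set.image_singleton, hJ', Ideal.map_span,
      ← Set.range_comp]
    rfl
  rw [hspan] at h
  set I' := (Ideal.span {π}).map (algebraMap W R)
  have hI'm : I' ≤ IsLocalRing.maximalIdeal R := le_sup_left.trans h.1.2
  have hJ'm : J' ≤ IsLocalRing.maximalIdeal R := le_sup_right.trans h.1.2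
  have : IsArtinianRing (R ⧸ I' ⊔ J') :=
    IsLocalRing.quotient_artinian_of_mem_minimalPrimes_of_isLocalRing _ h
  have f0 : Module.Finite W (R ⧸ I' ⊔ J') := by
    have hl : IsFiniteLength R (R ⧸ I' ⊔ J') := by
      have : IsArtinian R (R ⧸ I' ⊔ J') := by
        exact isArtinian_of_surjective_algebraMap (R := R ⧸ I' ⊔ J') Ideal.Quotient.mk_surjective
      exact isFiniteLength_iff_isNoetherian_isArtinian.2 ⟨inferInstance, this⟩
    exact hl.finite_of_residue_surjective hsurj
  have : IsHausdorff (.span {π} : Ideal W) (R ⧸ J') := by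
    rw [← IsHausdorff.map_algebraMap_iff (S := R)]
    exact .of_le_jacobson _ _ (hI'm.trans (IsLocalRing.maximalIdeal_le_jacobson _))
  have f1 : Module.Finite W ((R ⧸ J') ⧸ (Ideal.span {π} • ⊤ : Submodule W (R ⧸ J'))) := by
    let q : R →ₗ[W] (R ⧸ J') ⧸ (Ideal.span {π} • ⊤ : Submodule W (R ⧸ J')) :=
      (Submodule.mkQ _).comp (IsScalarTower.toAlgHom W R (R ⧸ J')).toLinearMap
    have hq : (I' ⊔ J').restrictScalars W ≤ LinearMap.ker q := by
      intro x hx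
      obtain ⟨y, hy, z, hz, rfl⟩ := Submodule.mem_sup.1 hx
      have hI' : I' = Ideal.span {algebraMap W R π} := by
        rw [← Set.image_singleton, ← Ideal.map_span]
      rw [hI', Ideal.mem_span_singleton'] at hy
      obtain ⟨r, rfl⟩ := hy
      rw [mul_comm, ← Algebra.smul_def, LinearMap.mem_ker, map_add, map_smul]
      have hz0 : q z = 0 := by
        have : (IsScalarTower.toAlgHom W R (R ⧸ J')) z = 0 := Ideal.Quotient.eq_zero_iff_mem.2 hz
        change Submodule.mkQ _ (IsScalarTower.toAlgHom W R (R ⧸ J') z) = 0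
        rw [this, map_zero]
      rw [hz0, add_zero]
      change π • Submodule.mkQ _ _ = 0
      rw [← map_smul, Submodule.mkQ_apply, Submodule.Quotient.mk_eq_zero]
      exact Submodule.smul_mem_smul (Ideal.mem_span_singleton_self π) trivial
    have : Module.Finite W (R ⧸ (I' ⊔ J').restrictScalars W) :=
      .equiv (Submodule.Quotient.restrictScalarsEquiv W (I' ⊔ J')).symm
    refine .of_surjective (Submodule.liftQ _ q hq) ?_
    rw [← LinearMap.range_eq_top, Submodule.range_liftQ, LinearMap.range_eq_top]
    exact (Submodule.mkQ_surjective _).comp Ideal.Quotient.mk_surjective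
  have f2 : Module.Finite W (R ⧸ J') := .of_finite_quotient_smul_top (Ideal.span {π})
  have f3 : Module.Finite A (R ⧸ J') := .of_restrictScalars_finite W A _
  have : IsHausdorff J R := by
    rw [← IsHausdorff.map_algebraMap_iff (S := R)]
    exact .of_le_jacobson _ _ (hJ'm.trans (IsLocalRing.maximalIdeal_le_jacobson _))
  have f4 : Module.Finite A (R ⧸ (J • ⊤ : Submodule A R)) := by
    rw [Ideal.smul_top_eq_map]
    exact .equiv (Submodule.Quotient.restrictScalarsEquiv A J').symm
  exact .of_finite_quotient_smul_top J

theorem IsAdicComplete.of_le_maximalIdeal {R : Type*} [CommRing R] [IsNoetherianRing R]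
    [IsLocalRing R] [IsAdicComplete (IsLocalRing.maximalIdeal R) R] {I : Ideal R}
    (hI : I ≤ IsLocalRing.maximalIdeal R) : IsAdicComplete I R where
  toIsHausdorff := .of_le_jacobson _ _ (hI.trans (IsLocalRing.maximalIdeal_le_jacobson _))
  prec' f hf := by
    obtain ⟨L, hL⟩ := IsPrecomplete.prec (I := IsLocalRing.maximalIdeal R) inferInstance (f := f)
      fun {m n} hmn ↦ (hf hmn).mono (Submodule.smul_mono (Ideal.pow_right_mono hI m) le_rfl)
    refine ⟨L, fun n ↦ ?_⟩
    rw [SModEq.sub_mem, smul_eq_mul, Ideal.mul_top, ← Ideal.Quotient.eq_zero_iff_mem]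
    have : IsHausdorff (IsLocalRing.maximalIdeal R) (R ⧸ I ^ n) :=
      .of_le_jacobson _ _ (IsLocalRing.maximalIdeal_le_jacobson _)
    refine this.haus _ fun m ↦ ?_
    have h1 : f n - f (max m n) ∈ I ^ n := by
      simpa [SModEq.sub_mem] using hf (le_max_right m n)
    have h2 : f (max m n) - L ∈ IsLocalRing.maximalIdeal R ^ m := by
      have := hL (max m n)
      simp only [SModEq.sub_mem, smul_eq_mul, Ideal.mul_top] at this
      exact Ideal.pow_le_pow_right (le_max_left m n) this
    have h3 : Ideal.Quotient.mk (I ^ n) (f n - L) = (f (max m n) - L) • 1 := by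
      rw [← sub_add_sub_cancel _ (f (max m n)), map_add, Ideal.Quotient.eq_zero_iff_mem.2 h1,
        zero_add, Algebra.smul_def, mul_one]
      rfl
    rw [h3, SModEq.zero]
    exact Submodule.smul_mem_smul h2 trivial

open WittVector in
theorem exists_ringHom_wittVector_residueField (R : Type*) [CommRing R] [IsLocalRing R] (p : ℕ)
    [Fact p.Prime] [CharP (IsLocalRing.ResidueField R) p]
    [PerfectRing (IsLocalRing.ResidueField R) p] [IsAdicComplete (IsLocalRing.maximalIdeal R) R]
    [IsAdicComplete (Ideal.span {(p : R)}) R] :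
    ∃ φ : WittVector p (IsLocalRing.ResidueField R) →+* R,
      ∀ x, IsLocalRing.residue R (φ x) = x.coeff 0 := by
  have hp : (p : R) ∈ IsLocalRing.maximalIdeal R := by
    rw [← IsLocalRing.residue_eq_zero_iff, map_natCast, CharP.cast_eq_zero]
  have : Fact (¬ IsUnit (p : R)) := ⟨(IsLocalRing.mem_maximalIdeal _).1 hp⟩
  have : CharP (R ⧸ IsLocalRing.maximalIdeal R) p := ‹CharP (IsLocalRing.ResidueField R) p›
  have : CharP (R ⧸ Ideal.span {(p : R)}) p := inferInstanceAs (CharP (ModP R p) p)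
  let fac : ModP R p →+* IsLocalRing.ResidueField R :=
    Ideal.Quotient.factor ((Ideal.span_singleton_le_iff_mem _).2 hp)
  let ψ : PreTilt R p →+* Perfection (IsLocalRing.ResidueField R) p := Perfection.map p fac
  have hψ : Function.Bijective ψ := by
    have h := (Perfection.quotientMulEquiv p (IsLocalRing.maximalIdeal R)).bijective
    exact (Function.Bijective.of_comp_iff ψ
      (Perfection.quotientMulEquiv p (Ideal.span {(p : R)})).bijective).1 h
  let e := RingEquiv.ofBijective ψ hψ
  let g : IsLocalRing.ResidueField R →+* PreTilt R p :=
    e.symm.toRingHom.comp (Perfection.lift p _ _ (RingHom.id _))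
  refine ⟨(fontaineTheta R p).comp (WittVector.map g), fun x ↦ ?_⟩
  have h1 : IsLocalRing.residue R (fontaineTheta R p (WittVector.map g x)) =
    fac (Ideal.Quotient.mk _ (fontaineTheta R p (WittVector.map g x))) := rfl
  rw [RingHom.comp_apply, h1, mk_fontaineTheta, WittVector.map_coeff]
  have h2 (y) : fac (PreTilt.coeff 0 y) = Perfection.coeff _ p 0 (ψ y) := rfl
  rw [h2]
  have h3 : ψ (g (x.coeff 0)) = Perfection.lift p _ _ (RingHom.id _) (x.coeff 0) :=
    e.apply_symm_apply _
  rw [h3]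
  rfl

section

open IsLocalRing

theorem ringKrullDim_quotient_span_pair_le {R : Type*} [CommRing R] [IsNoetherianRing R]
    {x y : R} (hx : x ∈ nonZeroDivisors R)
    (hy : ∀ P ∈ (Ideal.span {x}).minimalPrimes, y ∉ P) :
    ringKrullDim (R ⧸ Ideal.span {x, y}) + 1 + 1 ≤ ringKrullDim R := by
  refine le_trans ?_ (ringKrullDim_quotient_succ_le_of_nonZeroDivisor hx)
  gcongr
  rw [← Module.supportDim_quotient_eq_ringKrullDim (Ideal.span {x})]
  refine le_trans ?_ (Module.supportDim_quotSMulTop_succ_le_of_notMem_minimalPrimes (x := y) ?_)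
  · gcongr
    rw [ringKrullDim_quotient, Module.supportDim, Module.support_quotSMulTop,
      Module.support_eq_zeroLocus, Ideal.annihilator_quotient, PrimeSpectrum.zeroLocus_span, PrimeSpectrum.zeroLocus_span,
      ← PrimeSpectrum.zeroLocus_union, Set.singleton_union, Set.pair_comm]
  · rwa [Ideal.annihilator_quotient]

theorem IsDiscreteValuationRing.maximalIdeal_eq_span_of_notMem_sq {V : Type*} [CommRing V]
    [IsDomain V] [IsDiscreteValuationRing V] {x : V} (hx : x ∈ IsLocalRing.maximalIdeal V)
    (hx2 : x ∉ IsLocalRing.maximalIdeal V ^ 2) : IsLocalRing.maximalIdeal V = Ideal.span {x} := by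
  obtain ⟨ϖ, hϖ⟩ := IsDiscreteValuationRing.exists_irreducible V
  rw [hϖ.maximalIdeal_eq] at hx hx2 ⊢
  obtain ⟨u, rfl⟩ := Ideal.mem_span_singleton'.1 hx
  have hu : IsUnit u := by
    by_contra hu
    apply hx2
    have : u ∈ IsLocalRing.maximalIdeal V := (mem_maximalIdeal _).2 hu
    rw [hϖ.maximalIdeal_eq] at this
    rw [sq]
    exact Ideal.mul_mem_mul this (Ideal.mem_span_singleton_self ϖ)
  exact (Ideal.span_singleton_mul_left_unit hu ϖ).symm

theorem exists_mem_uniformizer_notMem_minimalPrimes {R : Type*} [CommRing R] [IsDomain R]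
    [IsNoetherianRing R] [IsLocalRing R] (Q : Ideal R) [Q.IsPrime]
    [IsDiscreteValuationRing (Localization.AtPrime Q)] {π : R} (hπQ : π ∉ Q) :
    ∃ x ∈ Q, maximalIdeal (Localization.AtPrime Q) =
      Ideal.span {algebraMap R (Localization.AtPrime Q) x} ∧
      ∀ P ∈ (Ideal.span {π}).minimalPrimes, x ∉ P := by
  set V := Localization.AtPrime Q
  have hQ : Q.height = 1 := by
    have := IsLocalization.AtPrime.ringKrullDim_eq_height Q V
    rw [IsDiscreteValuationRing.ringKrullDim_eq_one] at this
    exact_mod_cast this.symm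
  set Q2 : Ideal R := (maximalIdeal V ^ 2).comap (algebraMap R V)
  have hmin : (insert Q2 (Ideal.span {π}).minimalPrimes).Finite :=
    (Ideal.finite_minimalPrimes_of_isNoetherianRing R _).insert _
  have hnot : ¬ (Q : Set R) ⊆ ⋃ I ∈ insert Q2 (Ideal.span {π}).minimalPrimes, (I : Set R) := by
    refine mt (Ideal.subset_union_prime_finite hmin (f := id) Q2 Q2 ?_).1 ?_
    rotate_left
    · rintro ⟨I, hI | hI, hQI⟩
      · subst hI
        have h1 : maximalIdeal V ≤ maximalIdeal V ^ 2 :=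
          (Localization.AtPrime.map_eq_maximalIdeal (I := Q)).ge.trans
            (Ideal.map_le_iff_le_comap.2 hQI)
        have h2 : maximalIdeal V = ⊥ := by
          refine Submodule.eq_bot_of_le_smul_of_le_jacobson_bot (maximalIdeal V) _
            (IsNoetherian.noetherian _) ?_ (maximalIdeal_le_jacobson _)
          rwa [smul_eq_mul, ← sq]
        exact IsDiscreteValuationRing.not_a_field V h2
      · have : I.IsPrime := hI.1.1
        have hQI' : Q < I := lt_of_le_of_ne (show Q ≤ I from hQI) fun h ↦
          hπQ (h ▸ hI.1.2 (Ideal.mem_span_singleton_self π))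
        have h1 := Ideal.height_add_one_le_of_lt_of_isPrime (I := Q) (J := I) hQI'
        have h2 := Ideal.height_le_one_of_isPrincipal_of_mem_minimalPrimes _ _ hI
        rw [hQ] at h1
        exact absurd (h1.trans h2) (by decide)
    · rintro I (rfl | hI) h _
      · exact absurd rfl h
      · exact hI.1.1
  obtain ⟨x, hxQ, hx⟩ := Set.not_subset.1 hnot
  simp only [Set.mem_iUnion, not_exists, SetLike.mem_coe] at hx
  refine ⟨x, hxQ, IsDiscreteValuationRing.maximalIdeal_eq_span_of_notMem_sq ?_
    (hx Q2 (Set.mem_insert _ _)), fun P hP ↦ hx P (Set.mem_insert_of_mem _ hP)⟩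
  exact (IsLocalization.AtPrime.to_map_mem_maximal_iff V Q x).2 hxQ

theorem exists_fin_maximalIdeal_mem_minimalPrimes {B : Type*} [CommRing B] [IsNoetherianRing B]
    [IsLocalRing B] {n : ℕ} (hn : ringKrullDim B ≤ n) :
    ∃ y : Fin n → B, maximalIdeal B ∈ (Ideal.span (Set.range y)).minimalPrimes := by
  obtain ⟨s, hs, hcard⟩ := Ideal.exists_finset_card_eq_height_of_isNoetherianRing (maximalIdeal B)
  have hsn : s.card ≤ n := by
    rw [← maximalIdeal_height_eq_ringKrullDim, ← hcard] at hn
    exact_mod_cast hn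
  refine ⟨fun i ↦ s.toList.getD i 0, ?_⟩
  have hsub : (s : Set B) ⊆ Set.range fun i : Fin n ↦ s.toList.getD i 0 := by
    intro b hb
    obtain ⟨i, hi, rfl⟩ := List.getElem_of_mem (Finset.mem_toList.2 hb)
    refine ⟨⟨i, ?_⟩, List.getD_eq_getElem _ _ hi⟩
    rw [Finset.length_toList] at hi
    exact hi.trans_le hsn
  refine ⟨⟨inferInstance, Ideal.span_le.2 ?_⟩,
    fun P hP _ ↦ hs.2 ⟨hP.1, (Ideal.span_mono hsub).trans hP.2⟩ ‹_›⟩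
  rintro _ ⟨i, rfl⟩
  dsimp only
  by_cases hi : (i : ℕ) < s.toList.length
  · rw [List.getD_eq_getElem _ _ hi]
    exact hs.1.2 (Ideal.subset_span (Finset.mem_toList.1 (List.getElem_mem hi)))
  · rw [List.getD_eq_default _ _ (not_lt.1 hi)]
    exact zero_mem _

theorem exists_parameters_of_height_one {R : Type*} [CommRing R] [IsDomain R]
    [IsNoetherianRing R] [IsLocalRing R] (Q : Ideal R) [Q.IsPrime]
    [IsDiscreteValuationRing (Localization.AtPrime Q)] {π : R} (hπ : π ∈ maximalIdeal R)
    (hπQ : π ∉ Q) {n : ℕ} (hn : ringKrullDim R ≤ n + 1 + 1) :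
    ∃ x : Fin (n + 1) → R, x 0 ∈ Q ∧ maximalIdeal (Localization.AtPrime Q) =
      Ideal.span {algebraMap R (Localization.AtPrime Q) (x 0)} ∧
      maximalIdeal R ∈ (Ideal.span (insert π (Set.range x))).minimalPrimes := by
  obtain ⟨x₀, hx₀Q, hx₀, hmin⟩ := exists_mem_uniformizer_notMem_minimalPrimes Q hπQ
  have hπ0 : π ≠ 0 := by rintro rfl; exact hπQ Q.zero_mem
  set I := Ideal.span {π, x₀}
  have hdim : ringKrullDim (R ⧸ I) ≤ n := by
    have := (ringKrullDim_quotient_span_pair_le (mem_nonZeroDivisors_of_ne_zero hπ0) hmin).trans hn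
    exact ENat.WithBot.add_le_add_one_right_iff.1 (ENat.WithBot.add_le_add_one_right_iff.1 this)
  have hIm : I ≤ maximalIdeal R := by
    rw [Ideal.span_le, Set.pair_subset_iff]
    exact ⟨hπ, le_maximalIdeal (Ideal.IsPrime.ne_top ‹_›) hx₀Q⟩
  have : Nontrivial (R ⧸ I) := Ideal.Quotient.nontrivial_iff.2 fun h ↦
    (maximalIdeal.isMaximal R).ne_top (top_le_iff.1 (h ▸ hIm))
  have : IsLocalRing (R ⧸ I) := .of_surjective' (Ideal.Quotient.mk I) Ideal.Quotient.mk_surjective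
  obtain ⟨y, hy⟩ := exists_fin_maximalIdeal_mem_minimalPrimes hdim
  choose z hz using fun i ↦ Ideal.Quotient.mk_surjective (I := I) (y i)
  have hcomap : (maximalIdeal (R ⧸ I)).comap (Ideal.Quotient.mk I) = maximalIdeal R :=
    have := Ideal.comap_isMaximal_of_surjective _ (Ideal.Quotient.mk_surjective (I := I))
      (K := maximalIdeal (R ⧸ I))
    eq_maximalIdeal this
  refine ⟨Fin.cons x₀ z, hx₀Q, hx₀, ⟨inferInstance, ?_⟩, fun P ⟨hP, hPs⟩ _ ↦ ?_⟩
  · rw [Ideal.span_le, Set.insert_subset_iff]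
    refine ⟨hπ, ?_⟩
    rintro _ ⟨i, rfl⟩
    refine Fin.cases (hIm (Ideal.subset_span (by simp))) (fun i ↦ ?_) i
    change z i ∈ maximalIdeal R
    rw [← hcomap, Ideal.mem_comap, hz]
    exact hy.1.2 (Ideal.subset_span ⟨i, rfl⟩)
  · have hIP : I ≤ P := (Ideal.span_mono (by
      rw [Fin.range_cons]
      exact Set.insert_subset_insert (by simp))).trans hPs
    have hPprime : (P.map (Ideal.Quotient.mk I)).IsPrime :=
      Ideal.map_isPrime_of_surjective Ideal.Quotient.mk_surjective (by rwa [Ideal.mk_ker])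
    have h1 : maximalIdeal (R ⧸ I) ≤ P.map (Ideal.Quotient.mk I) := by
      refine hy.2 ⟨hPprime, Ideal.span_le.2 ?_⟩ (le_maximalIdeal hPprime.ne_top)
      rintro _ ⟨i, rfl⟩
      rw [← hz]
      exact Ideal.mem_map_of_mem _ (hPs (Ideal.subset_span (.inr ⟨i.succ, by simp⟩)))
    rw [← hcomap]
    refine (Ideal.comap_mono h1).trans ?_
    rw [Ideal.comap_map_of_surjective' _ Ideal.Quotient.mk_surjective, Ideal.mk_ker]
    exact sup_le le_rfl hIP

end

theorem exists_mvPowerSeries_eval₂ {σ W R : Type*} [Finite σ] [CommRing W] [CommRing R]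
    (I : Ideal R) [hI : IsAdicComplete I R] (φ : W →+* R) (x : σ → R) (hx : ∀ i, x i ∈ I) :
    ∃ ι : MvPowerSeries σ W →+* R,
      (∀ w, ι (MvPowerSeries.C w) = φ w) ∧ ∀ i, ι (MvPowerSeries.X i) = x i := by
  let : WithIdeal R := ⟨I⟩
  let : UniformSpace W := ⊥
  have : DiscreteTopology W := ⟨rfl⟩
  have : IsUniformAddGroup W := inferInstance
  have hadic : IsAdic I := rfl
  obtain ⟨hc, ht⟩ := hadic.isAdicComplete_iff.mp hI
  have hφ : Continuous φ := continuous_of_discreteTopology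
  have ha : MvPowerSeries.HasEval x :=
    ⟨fun s ↦ WithIdeal.isTopologicallyNilpotent_of_mem (hx s), by
      rw [Filter.cofinite_eq_bot]; exact Filter.tendsto_bot⟩
  refine ⟨MvPowerSeries.eval₂Hom hφ ha, fun w ↦ ?_, fun i ↦ ?_⟩
  · rw [MvPowerSeries.coe_eval₂Hom, MvPowerSeries.eval₂_C]
  · rw [MvPowerSeries.coe_eval₂Hom, MvPowerSeries.eval₂_X]

theorem PowerSeries.X_mem_ringJacobson (B : Type*) [CommRing B] :
    (PowerSeries.X : PowerSeries B) ∈ Ring.jacobson (PowerSeries B) := by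
  rw [← Ideal.jacobson_bot, Ideal.mem_jacobson_bot]
  intro y
  rw [PowerSeries.isUnit_iff_constantCoeff]
  simp

theorem PowerSeries.ringKrullDim_le (B : Type*) [CommRing B] [IsNoetherianRing B] :
    ringKrullDim (PowerSeries B) ≤ ringKrullDim B + 1 := by
  have h := ringKrullDim_le_ringKrullDim_quotient_add_card {(PowerSeries.X : PowerSeries B)}
    (by simpa using PowerSeries.X_mem_ringJacobson B)
  refine h.trans ?_
  rw [Finset.card_singleton, Nat.cast_one, Finset.coe_singleton]
  gcongr
  refine ringKrullDim_le_of_surjective ((Ideal.Quotient.mk _).comp PowerSeries.C) fun y ↦ ?_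
  obtain ⟨f, rfl⟩ := Ideal.Quotient.mk_surjective y
  refine ⟨PowerSeries.constantCoeff f, ?_⟩
  rw [RingHom.comp_apply, Ideal.Quotient.eq, Ideal.mem_span_singleton, PowerSeries.X_dvd_iff]
  simp

theorem MvPowerSeries.ringKrullDim_fin_le (B : Type*) [CommRing B] [IsNoetherianRing B] (n : ℕ) :
    ringKrullDim (MvPowerSeries (Fin n) B) ≤ ringKrullDim B + n := by
  induction n with
  | zero =>
    rw [ringKrullDim_eq_of_ringEquiv (MvPowerSeries.isEmptyEquiv (Fin 0) B).toRingEquiv]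
    simp
  | succ n ih =>
    rw [ringKrullDim_eq_of_ringEquiv (MvPowerSeries.finSuccEquiv B n).toRingEquiv]
    refine (PowerSeries.ringKrullDim_le _).trans ?_
    rw [Nat.cast_add, ← add_assoc, Nat.cast_one]
    gcongr

theorem MvPowerSeries.prime_X_zero (B : Type*) [CommRing B] [IsDomain B] (n : ℕ) :
    Prime (MvPowerSeries.X 0 : MvPowerSeries (Fin (n + 1)) B) := by
  have : IsDomain (MvPowerSeries (Fin n) B) := {}
  rw [← MulEquiv.prime_iff (MvPowerSeries.finSuccEquiv B n).toRingEquiv]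
  have : (MvPowerSeries.finSuccEquiv B n).toRingEquiv (MvPowerSeries.X 0) = PowerSeries.X := by
    exact MvPowerSeries.finSuccEquiv_X_zero
  rw [this]
  exact PowerSeries.X_prime

theorem ringKrullDim_le_of_isIntegral {A B : Type*} [CommRing A] [CommRing B] [Algebra A B]
    [Algebra.IsIntegral A B] : ringKrullDim B ≤ ringKrullDim A :=
  Order.krullDim_le_of_strictMono (PrimeSpectrum.comap (algebraMap A B)) fun _ _ h ↦
    Ideal.IsIntegral.comap_lt_comap h

theorem RingHom.injective_of_isIntegral_of_ringKrullDim_le {A B : Type*} [CommRing A] [CommRing B]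
    [IsDomain A] [FiniteRingKrullDim B] {f : A →+* B} (hf : f.IsIntegral)
    (h : ringKrullDim A ≤ ringKrullDim B) : Function.Injective f := by
  rw [injective_iff_map_eq_zero]
  intro a ha
  by_contra ha0
  let := f.toAlgebra
  have : Algebra.IsIntegral A B := ⟨hf⟩
  have h1 := ringKrullDim_succ_le_of_surjective f.rangeRestrict f.rangeRestrict_surjective
    (mem_nonZeroDivisors_of_ne_zero ha0) (Subtype.ext ha)
  have : Algebra.IsIntegral f.range B := by
    refine ⟨fun x ↦ ?_⟩
    obtain ⟨q, hq, hx⟩ := hf x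
    refine ⟨q.map f.rangeRestrict, hq.map _, ?_⟩
    rw [Polynomial.eval₂_map]
    exact hx
  have h2 : ringKrullDim B ≤ ringKrullDim f.range := ringKrullDim_le_of_isIntegral
  obtain ⟨m, hm⟩ : ∃ m : ℕ, ringKrullDim B = m := by
    obtain ⟨m, hm⟩ := WithBot.ne_bot_iff_exists.mp (ringKrullDim_ne_bot (R := B))
    have h3 : m ≠ ⊤ := fun h ↦ ringKrullDim_ne_top (R := B) (by rw [← hm, h]; rfl)
    exact ⟨m.toNat, by rw [← hm, ← ENat.natCast_toNat h3]; rfl⟩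
  have h4 : ((m : WithBot ℕ∞) + 1) ≤ m := by
    rw [← hm]
    exact (add_le_add_left h2 1).trans (h1.trans h)
  have h5 : m + 1 ≤ m := by exact_mod_cast h4
  omega

theorem IsDiscreteValuationRing.localization_atPrime_span_singleton {A : Type*} [CommRing A]
    [IsDomain A] [IsNoetherianRing A] {t : A} (ht : t ≠ 0) (P : Ideal A) [P.IsPrime]
    (hP : P = Ideal.span {t}) : IsDiscreteValuationRing (Localization.AtPrime P) := by
  have hm := Localization.AtPrime.map_eq_maximalIdeal (I := P)
  have hnf : ¬ IsField (Localization.AtPrime P) := by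
    rw [IsLocalRing.isField_iff_maximalIdeal_eq, ← hm]
    intro h
    rw [Ideal.map_eq_bot_iff_of_injective
      (IsLocalization.injective _ P.primeCompl_le_nonZeroDivisors)] at h
    rw [h, eq_comm, Ideal.span_singleton_eq_bot] at hP
    exact ht hP
  refine ((IsDiscreteValuationRing.TFAE _ hnf).out 4 0).mp ?_
  refine ⟨⟨algebraMap A _ t, ?_⟩⟩
  rw [← hm]
  exact (congrArg (Ideal.map _) hP).trans (by rw [Ideal.map_span, Set.image_singleton])

theorem localRingHom_flat_and_formallyUnramified {A R : Type*} [CommRing A] [CommRing R]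
    [IsDomain A] [IsDomain R] [IsNoetherianRing A] {ι : A →+* R} (hinj : Function.Injective ι)
    (hfin : letI := ι.toAlgebra; Module.Finite A R) (Q : Ideal R) [Q.IsPrime] [CharZero (R ⧸ Q)]
    {t : A} (ht : t ≠ 0) (hP : Q.comap ι = Ideal.span {t})
    (hQ : IsLocalRing.maximalIdeal (Localization.AtPrime Q) =
      Ideal.span {algebraMap R (Localization.AtPrime Q) (ι t)}) :
    letI := (Localization.localRingHom (Q.comap ι) Q ι rfl).toAlgebra
    Module.Flat (Localization.AtPrime (Q.comap ι)) (Localization.AtPrime Q) ∧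
      Algebra.FormallyUnramified (Localization.AtPrime (Q.comap ι)) (Localization.AtPrime Q) := by
  let := ι.toAlgebra
  let := (Localization.localRingHom (Q.comap ι) Q ι rfl).toAlgebra
  have : Module.Finite A R := hfin
  have : Q.LiesOver (Q.comap ι) := ⟨rfl⟩
  have : Localization.AtPrime.IsLiesOverAlgebra (Q.comap ι) Q := ⟨rfl⟩
  have := IsDiscreteValuationRing.localization_atPrime_span_singleton ht (Q.comap ι) hP
  constructor
  · have : Module.IsTorsionFree (Localization.AtPrime (Q.comap ι)) (Localization.AtPrime Q) := by
      have hD : IsDomain (Localization.AtPrime Q) := IsLocalization.isDomain_localization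
        Q.primeCompl_le_nonZeroDivisors
      have h0 : (0 : R) ∉ Q.primeCompl := fun h ↦ h Q.zero_mem
      have hloc : Function.Injective (Localization.localRingHom (Q.comap ι) Q ι rfl) :=
        IsLocalization.map_injective_of_injective' _ _ _ _ h0 hinj
      exact Module.isTorsionFree_iff_algebraMap_injective.mpr hloc
    infer_instance
  · have : CharZero (Q.comap ι).ResidueField := by
      have : CharZero (A ⧸ Q.comap ι) :=
        (Ideal.quotientMap Q ι le_rfl).charZero
      exact charZero_of_injective_algebraMap (Ideal.injective_algebraMap_quotient_residueField _)
    have : Algebra.IsSeparable (Q.comap ι).ResidueField Q.ResidueField := inferInstance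
    have := (Algebra.isUnramifiedAt_iff_map_eq A (Q.comap ι) Q).mpr ⟨this, by
      rw [hP, Ideal.map_span, Set.image_singleton, hQ]; rfl⟩
    exact .of_restrictScalars A _ _

theorem Ideal.comap_eq_span_singleton_of_height_le_one {A R : Type*} [CommRing A] [CommRing R]
    [IsDomain R] [IsIntegrallyClosed A] {ι : A →+* R} (hinj : Function.Injective ι)
    (hint : ι.IsIntegral) (Q : Ideal R) [Q.IsPrime] (hQ : Q.height ≤ 1) {t : A} (ht : Prime t)
    (htQ : ι t ∈ Q) : Q.comap ι = Ideal.span {t} := by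
  let := ι.toAlgebra
  have : FaithfulSMul A R := (faithfulSMul_iff_algebraMap_injective A R).mpr hinj
  have : Algebra.IsIntegral A R := ⟨hint⟩
  have := (Ideal.span_singleton_prime ht.ne_zero).mpr ht
  by_contra hne
  have hlt : Ideal.span {t} < Q.comap ι :=
    lt_of_le_of_ne ((Ideal.span_singleton_le_iff_mem _).mpr htQ) (Ne.symm hne)
  have : Q.LiesOver (Q.comap ι) := ⟨rfl⟩
  obtain ⟨Q', hQ'lt, hQ', hover⟩ := Ideal.exists_ideal_lt_liesOver_of_lt (p := Ideal.span {t})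
    (q := Q.comap ι) Q hlt
  have h0 : Q' ≠ ⊥ := by
    rintro rfl
    have : ι t ∈ (⊥ : Ideal R) := by
      have h : t ∈ Ideal.span {t} := Ideal.mem_span_singleton_self t
      rw [hover.over] at h
      exact h
    exact ht.ne_zero (hinj (by simpa using this))
  have h1 := Ideal.height_add_one_le_of_lt_of_isPrime hQ'lt
  have h2 := Ideal.height_add_one_le_of_lt_of_isPrime (bot_lt_iff_ne_bot.mpr h0)
  have h3 : (1 : ℕ∞) + 1 ≤ 1 :=
    (add_le_add_left (le_trans (by simp) h2) 1).trans (h1.trans hQ)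
  exact absurd h3 (by decide)

theorem IsDiscreteValuationRing.of_ringKrullDim_eq_one {V : Type*} [CommRing V] [IsDomain V]
    [IsNoetherianRing V] [IsLocalRing V] [IsIntegrallyClosed V] (h : ringKrullDim V = 1) :
    IsDiscreteValuationRing V := by
  have hnf : ¬ IsField V := fun hf ↦ by
    simp [ringKrullDim_eq_zero_of_isField hf] at h
  have : Ring.KrullDimLE 1 V := Ring.krullDimLE_iff.mpr h.le
  have hdvr : IsIntegrallyClosed V ∧ (∃! P : Ideal V, P ≠ ⊥ ∧ P.IsPrime) →
      IsDiscreteValuationRing V := ((IsDiscreteValuationRing.TFAE V hnf).out 0 3).mpr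
  refine hdvr ⟨inferInstance, IsLocalRing.maximalIdeal V, ⟨?_, inferInstance⟩, fun P hP ↦ ?_⟩
  · rwa [Ne, ← IsLocalRing.isField_iff_maximalIdeal_eq]
  · exact IsLocalRing.eq_maximalIdeal (hP.2.isMaximal_of_ne_bot hP.1)

theorem two_le_ringKrullDim_of_height_eq_one {R : Type*} [CommRing R] [IsLocalRing R]
    (Q : Ideal R) [Q.IsPrime] (hQ : Q.height = 1) (hne : Q ≠ IsLocalRing.maximalIdeal R) :
    2 ≤ ringKrullDim R := by
  have h := Ideal.height_add_one_le_of_lt_of_isPrime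
    (lt_of_le_of_ne (IsLocalRing.le_maximalIdeal Ideal.IsPrime.ne_top') hne)
  rw [hQ] at h
  rw [← IsLocalRing.maximalIdeal_height_eq_ringKrullDim]
  rw [one_add_one_eq_two] at h
  exact WithBot.coe_le_coe.mpr h

/-- Choice of Noether coordinates adapted to a height one prime: if `(R, 𝔪, k)` is a complete
Noetherian normal local domain of dimension `d` with `k` perfect of characteristic `p`, and
`Q ⊆ R` is a height one prime such that `R` and `R ⧸ Q` have mixed characteristic, then there
is an injective local homomorphism `ι : W(k)[[x_1, …, x_{d-1}]] → R` making `R` module-finite,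
with `ι⁻¹(Q)` generated by one of the power series variables, and such that the induced map on
localizations (at `ι⁻¹(Q)` and at `Q`) is flat and formally unramified (essentially étale). -/
theorem exists_noether_coordinates (R : Type u) [CommRing R] [IsDomain R]
    [IsNoetherianRing R] [IsLocalRing R] [IsIntegrallyClosed R]
    (hcomplete : IsAdicComplete (IsLocalRing.maximalIdeal R) R)
    (d p : ℕ) [Fact p.Prime]
    (hdim : ringKrullDim R = (d : WithBot ℕ∞))
    (hchar : CharP (IsLocalRing.ResidueField R) p)
    (hperfect : ∀ x : IsLocalRing.ResidueField R, ∃ y, y ^ p = x)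
    (Q : Ideal R) [Q.IsPrime]
    (hht : ringKrullDim (Localization.AtPrime Q) = (1 : WithBot ℕ∞))
    (hmixedR : MixedCharLocal R) :
    letI : IsLocalRing (R ⧸ Q) :=
      IsLocalRing.of_surjective' (Ideal.Quotient.mk Q) Ideal.Quotient.mk_surjective
    MixedCharLocal (R ⧸ Q) →
      ∃ (ι : MvPowerSeries (Fin (d - 1)) (WittVector p (IsLocalRing.ResidueField R)) →+* R)
        (j : Fin (d - 1)),
        Function.Injective ι ∧ IsLocalHom ι ∧
        (letI := ι.toAlgebra;
          Module.Finite (MvPowerSeries (Fin (d - 1)) (WittVector p (IsLocalRing.ResidueField R)))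
            R) ∧
        Q.comap ι = Ideal.span {MvPowerSeries.X j} ∧
        (letI := (Localization.localRingHom (Q.comap ι) Q ι rfl).toAlgebra;
          Module.Flat (Localization.AtPrime (Q.comap ι)) (Localization.AtPrime Q) ∧
          Algebra.FormallyUnramified (Localization.AtPrime (Q.comap ι))
            (Localization.AtPrime Q)) := by
  intro hmixedQ
  have hp := Fact.out (p := p.Prime)
  let k := IsLocalRing.ResidueField R
  have : PerfectRing k p := .ofSurjective k p hperfect
  have hpm : (p : R) ∈ IsLocalRing.maximalIdeal R := by
    rw [← IsLocalRing.residue_eq_zero_iff, map_natCast]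
    exact CharP.cast_eq_zero k p
  have := hmixedQ.1
  have hpQ : (p : R) ∉ Q := fun h ↦ by
    rw [← Ideal.Quotient.eq_zero_iff_mem, map_natCast] at h
    exact hp.ne_zero (Nat.cast_eq_zero.mp h)
  have hQ1 : Q.height = 1 := by
    rw [IsLocalization.AtPrime.ringKrullDim_eq_height Q] at hht
    exact_mod_cast hht
  obtain ⟨n, rfl⟩ : ∃ n, d = n + 2 := by
    have h := two_le_ringKrullDim_of_height_eq_one Q hQ1 fun h ↦ hpQ (h ▸ hpm)
    rw [hdim] at h
    have h2 : 2 ≤ d := by exact_mod_cast h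
    exact ⟨d - 2, by omega⟩
  have : IsDomain (Localization.AtPrime Q) :=
    IsLocalization.isDomain_localization Q.primeCompl_le_nonZeroDivisors
  have : IsIntegrallyClosed (Localization.AtPrime Q) :=
    isIntegrallyClosed_of_isLocalization _ Q.primeCompl Q.primeCompl_le_nonZeroDivisors
  have : IsDiscreteValuationRing (Localization.AtPrime Q) := .of_ringKrullDim_eq_one hht
  obtain ⟨x, hx0, hxm, hmin⟩ := exists_parameters_of_height_one Q hpm hpQ (n := n)
    (by rw [hdim]; push_cast; rw [add_assoc, one_add_one_eq_two])
  have hxmem (i) : x i ∈ IsLocalRing.maximalIdeal R :=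
    hmin.1.2 (Ideal.subset_span (.inr ⟨i, rfl⟩))
  have : IsAdicComplete (Ideal.span {(p : R)}) R :=
    .of_le_maximalIdeal ((Ideal.span_singleton_le_iff_mem _).mpr hpm)
  obtain ⟨φ, hφ⟩ := exists_ringHom_wittVector_residueField R p
  obtain ⟨ι, hιC, hιX⟩ := exists_mvPowerSeries_eval₂ _ φ x hxmem
  have hfin : letI := ι.toAlgebra
      Module.Finite (MvPowerSeries (Fin (n + 1)) (WittVector p k)) R := by
    let := ι.toAlgebra
    let := φ.toAlgebra
    have : IsScalarTower (WittVector p k) (MvPowerSeries (Fin (n + 1)) (WittVector p k)) R :=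
      .of_algebraMap_eq fun w ↦ (hιC w).symm
    refine module_finite_mvPowerSeries (W := WittVector p k) (p : WittVector p k) (fun y ↦ ?_) ?_
    · exact ⟨WittVector.teichmuller p y, (hφ _).trans (WittVector.teichmuller_coeff_zero p y)⟩
    · rw [map_natCast]
      simp only [RingHom.algebraMap_toAlgebra, hιX]
      exact hmin
  have hint : ι.IsIntegral := by
    let := ι.toAlgebra
    exact (algebraMap_isIntegral_iff (A := R)).mpr (Algebra.IsIntegral.of_finite _ _)
  have : IsDomain (MvPowerSeries (Fin (n + 1)) (WittVector p k)) := {}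
  have hinj : Function.Injective ι := by
    have : FiniteRingKrullDim R := inferInstance
    refine RingHom.injective_of_isIntegral_of_ringKrullDim_le hint ?_
    refine (MvPowerSeries.ringKrullDim_fin_le _ _).trans ?_
    rw [hdim, IsPrincipalIdealRing.ringKrullDim_eq_one _ (IsDiscreteValuationRing.not_isField _)]
    push_cast
    rw [add_comm, add_assoc, one_add_one_eq_two]
  have hX := MvPowerSeries.prime_X_zero (WittVector p k) n
  have hcomap : Q.comap ι = Ideal.span {MvPowerSeries.X 0} :=
    Q.comap_eq_span_singleton_of_height_le_one hinj hint hQ1.le hX (hιX 0 ▸ hx0)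
  refine ⟨ι, (0 : Fin (n + 1)), hinj, hint.isLocalHom hinj, hfin, hcomap, ?_⟩
  exact localRingHom_flat_and_formallyUnramified hinj hfin Q hX.ne_zero hcomap
    (by rw [hιX]; exact hxm)
end

section
/- Let (A,𝔪) be a Noetherian regular local ring and let B be a balanced big Cohen-Macaulay A-algebra. Then B is a faithfully flat A-module. -/
/-- A list of elements of a Noetherian local ring is a system of parameters if it consists of
elements of the maximal ideal, has length equal to the Krull dimension, and the radical of the
ideal it generates is the maximal ideal. -/
def IsSOP (R : Type*) [CommRing R] [IsLocalRing R] (xs : List R) : Prop :=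
  (∀ x ∈ xs, x ∈ IsLocalRing.maximalIdeal R) ∧
    (xs.length : WithBot ℕ∞) = ringKrullDim R ∧
    (Ideal.span {x | x ∈ xs}).radical = IsLocalRing.maximalIdeal R

/-- An `R`-algebra `B` is a balanced big Cohen-Macaulay algebra for the local ring `(R, 𝔪)` if
`𝔪 B ≠ B` and every system of parameters of `R` is a regular sequence on `B`, i.e. each
parameter is a nonzerodivisor modulo the previous ones. -/
def IsBalancedBigCM (R B : Type*) [CommRing R] [IsLocalRing R] [CommRing B] [Algebra R B] :
    Prop :=
  (IsLocalRing.maximalIdeal R).map (algebraMap R B) ≠ ⊤ ∧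
    ∀ xs : List R, IsSOP R xs → RingTheory.Sequence.IsWeaklyRegular B xs

universe u v

open IsLocalRing RingTheory.Sequence

section Parameters

lemma withBot_enat_eq_natCast_of_add_one_eq {a : WithBot ℕ∞} {n : ℕ}
    (h : a + 1 = (n : WithBot ℕ∞) + 1) : a = n := by
  induction a with
  | bot =>
    rw [WithBot.bot_add] at h
    exact absurd h.symm (WithBot.coe_ne_bot (a := (n : ℕ∞) + 1))
  | coe a =>
    have h' : a + 1 = (n : ℕ∞) + 1 := by exact_mod_cast h
    exact_mod_cast (ENat.add_left_injective_of_ne_top ENat.one_ne_top) h'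

variable {A : Type*} [CommRing A]

lemma ringKrullDim_quotient_ofList_cons (x : A) (xs : List A) :
    ringKrullDim (A ⧸ Ideal.ofList (x :: xs)) =
      Module.supportDim A (QuotSMulTop x (A ⧸ Ideal.ofList xs)) := by
  have h (l : List A) : Ideal.ofList l • (⊤ : Submodule A A) = Ideal.ofList l := Ideal.mul_top _
  have e := Submodule.quotOfListConsSMulTopEquivQuotSMulTopOuter A x xs
  rw [h, h] at e
  rw [← Module.supportDim_quotient_eq_ringKrullDim, Module.supportDim_eq_of_equiv e]

lemma ringKrullDim_quotient_ofList_nil :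
    ringKrullDim (A ⧸ Ideal.ofList ([] : List A)) = ringKrullDim A := by
  rw [Ideal.ofList_nil]
  exact ringKrullDim_eq_of_ringEquiv (RingEquiv.quotientBot A)

lemma ofList_le_of_forall_mem {xs : List A} {p : Ideal A} (h : ∀ x ∈ xs, x ∈ p) :
    Ideal.ofList xs ≤ p :=
  Ideal.span_le.mpr h

variable [IsLocalRing A]

lemma isSOP_iff_ofList {xs : List A} :
    IsSOP A xs ↔ (∀ x ∈ xs, x ∈ maximalIdeal A) ∧ (xs.length : WithBot ℕ∞) = ringKrullDim A ∧
      (Ideal.ofList xs).radical = maximalIdeal A := Iff.rfl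

lemma IsSOP.perm {xs ys : List A} (h : IsSOP A xs) (hp : xs.Perm ys) : IsSOP A ys := by
  obtain ⟨h1, h2, h3⟩ := h
  refine ⟨fun x hx ↦ h1 x (hp.mem_iff.mpr hx), hp.length_eq ▸ h2, ?_⟩
  simpa only [hp.mem_iff] using h3

lemma radical_eq_maximalIdeal_iff_ringKrullDim {I : Ideal A} (hI : I ≤ maximalIdeal A) :
    I.radical = maximalIdeal A ↔ ringKrullDim (A ⧸ I) = 0 := by
  have hne : I ≠ ⊤ := fun h ↦ (maximalIdeal.isMaximal A).ne_top (top_le_iff.mp (h ▸ hI))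
  have : Nontrivial (A ⧸ I) := Ideal.Quotient.nontrivial_iff.mpr hne
  rw [← ringKrullDimZero_iff_ringKrullDim_eq_zero,
    Ideal.krullDimLE_zero_quotient_iff_forall_minimalPrimes_isMaximal]
  constructor
  · intro h J hJ
    have := hJ.isPrime
    have : maximalIdeal A ≤ J := h ▸ (Ideal.IsPrime.radical_le_iff hJ.isPrime).mpr hJ.le
    rw [← (maximalIdeal.isMaximal A).eq_of_le hJ.isPrime.ne_top this]
    exact maximalIdeal.isMaximal A
  · intro h
    apply le_antisymm ((Ideal.IsPrime.radical_le_iff (maximalIdeal.isMaximal A).isPrime).mpr hI)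
    rw [← Ideal.sInf_minimalPrimes]
    exact le_sInf fun J hJ ↦ (eq_maximalIdeal (h J hJ)).ge

lemma radical_eq_maximalIdeal_of_mem_minimalPrimes {I : Ideal A}
    (h : maximalIdeal A ∈ I.minimalPrimes) : I.radical = maximalIdeal A := by
  rw [← Ideal.sInf_minimalPrimes]
  refine le_antisymm (sInf_le h) (le_sInf fun J hJ ↦ ?_)
  exact h.2 hJ.1 (le_maximalIdeal hJ.isPrime.ne_top)

variable [IsNoetherianRing A]

lemma ringKrullDim_quotient_ofList_cons_add_one {x : A} {xs : List A}
    (hn : ∀ p ∈ (Ideal.ofList xs).minimalPrimes, x ∉ p) (hx : x ∈ maximalIdeal A) :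
    ringKrullDim (A ⧸ Ideal.ofList (x :: xs)) + 1 = ringKrullDim (A ⧸ Ideal.ofList xs) := by
  rw [ringKrullDim_quotient_ofList_cons, ← Module.supportDim_quotient_eq_ringKrullDim]
  exact Module.supportDim_quotSMulTop_succ_eq_of_notMem_minimalPrimes_of_mem_maximalIdeal
    (by rwa [Ideal.annihilator_quotient]) hx

lemma ringKrullDim_quotient_ofList_le_cons {x : A} {xs : List A} (hx : x ∈ maximalIdeal A) :
    ringKrullDim (A ⧸ Ideal.ofList xs) ≤ ringKrullDim (A ⧸ Ideal.ofList (x :: xs)) + 1 := by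
  rw [ringKrullDim_quotient_ofList_cons, ← Module.supportDim_quotient_eq_ringKrullDim]
  exact Module.supportDim_le_supportDim_quotSMulTop_succ hx

lemma ringKrullDim_le_quotient_ofList_add_length {xs : List A}
    (h : ∀ x ∈ xs, x ∈ maximalIdeal A) :
    ringKrullDim A ≤ ringKrullDim (A ⧸ Ideal.ofList xs) + xs.length := by
  induction xs with
  | nil => rw [ringKrullDim_quotient_ofList_nil]; simp
  | cons x xs ih =>
    calc _ ≤ _ := ih fun y hy ↦ h y (List.mem_cons_of_mem _ hy)
      _ ≤ (ringKrullDim (A ⧸ Ideal.ofList (x :: xs)) + 1) + xs.length := by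
        gcongr
        exact ringKrullDim_quotient_ofList_le_cons (h x List.mem_cons_self)
      _ = _ := by
        rw [List.length_cons, add_assoc]; push_cast; rw [add_comm (1 : WithBot ℕ∞)]

/-- A sequence in the prime `p` along which the dimension drops as much as possible extends to
such a sequence over which `p` is minimal. -/
lemma exists_append_mem_minimalPrimes_ofList (p : Ideal A) [p.IsPrime] (n : ℕ) (xs : List A)
    (hxs : ∀ x ∈ xs, x ∈ p) (hn : ringKrullDim (A ⧸ Ideal.ofList xs) = n)
    (hd : ringKrullDim (A ⧸ Ideal.ofList xs) + xs.length = ringKrullDim A) :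
    ∃ ys : List A, (∀ y ∈ ys ++ xs, y ∈ p) ∧ p ∈ (Ideal.ofList (ys ++ xs)).minimalPrimes ∧
      ringKrullDim (A ⧸ Ideal.ofList (ys ++ xs)) + (ys ++ xs).length = ringKrullDim A := by
  induction n generalizing xs with
  | zero =>
    have hle := ofList_le_of_forall_mem hxs
    have hrad := (radical_eq_maximalIdeal_iff_ringKrullDim
      (hle.trans (le_maximalIdeal Ideal.IsPrime.ne_top'))).mpr hn
    refine ⟨[], hxs, ⟨⟨‹_›, hle⟩, fun q hq _ ↦ ?_⟩, hd⟩
    exact (le_maximalIdeal Ideal.IsPrime.ne_top').trans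
      (hrad ▸ (Ideal.IsPrime.radical_le_iff hq.1).mpr hq.2)
  | succ n ih =>
    by_cases hmin : p ∈ (Ideal.ofList xs).minimalPrimes
    · exact ⟨[], hxs, hmin, hd⟩
    have hle := ofList_le_of_forall_mem hxs
    obtain ⟨x, hxp, hx⟩ : ∃ x ∈ p, ∀ q ∈ (Ideal.ofList xs).minimalPrimes, x ∉ q := by
      by_contra! hcon
      obtain ⟨q, hq, hpq⟩ := (Ideal.subset_union_prime_finite
        (Ideal.finite_minimalPrimes_of_isNoetherianRing A (Ideal.ofList xs)) (f := id) ⊥ ⊥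
        fun q hq _ _ ↦ hq.isPrime).mp (fun x hx ↦ by simpa using! hcon x hx)
      exact hmin (le_antisymm hpq (hq.2 ⟨‹_›, hle⟩ hpq) ▸ hq)
    have hdim := ringKrullDim_quotient_ofList_cons_add_one hx
      (le_maximalIdeal Ideal.IsPrime.ne_top' hxp)
    have hn' : ringKrullDim (A ⧸ Ideal.ofList (x :: xs)) = n := by
      rw [hn] at hdim
      push_cast at hdim
      exact withBot_enat_eq_natCast_of_add_one_eq hdim
    obtain ⟨ys, h1, h2, h3⟩ := ih (x :: xs) (by simpa [hxp] using hxs) hn' (by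
      rw [← hd, ← hdim, List.length_cons, add_assoc]; push_cast; rw [add_comm (1 : WithBot ℕ∞)])
    have e : ys ++ [x] ++ xs = ys ++ x :: xs := by simp
    exact ⟨ys ++ [x], by rwa [e], by rwa [e], by rwa [e]⟩

/-- Every prime of a Noetherian local ring is minimal over an ideal generated by part of a system
of parameters. -/
lemma exists_isSOP_append_mem_minimalPrimes (p : Ideal A) [p.IsPrime] :
    ∃ xs ys : List A, IsSOP A (xs ++ ys) ∧ p ∈ (Ideal.ofList xs).minimalPrimes := by
  have key (xs : List A) (h : ringKrullDim (A ⧸ Ideal.ofList xs) + xs.length = ringKrullDim A)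
      (hxs : ∀ x ∈ xs, x ∈ maximalIdeal A) : ∃ n : ℕ, ringKrullDim (A ⧸ Ideal.ofList xs) = n := by
    have : Nontrivial (A ⧸ Ideal.ofList xs) := Ideal.Quotient.nontrivial_iff.mpr fun h ↦
      (maximalIdeal.isMaximal A).ne_top (top_le_iff.mp (h ▸ ofList_le_of_forall_mem hxs))
    have : IsLocalRing (A ⧸ Ideal.ofList xs) :=
      .of_surjective' (Ideal.Quotient.mk _) Ideal.Quotient.mk_surjective
    obtain ⟨m, hm⟩ := WithBot.ne_bot_iff_exists.mp (ringKrullDim_ne_bot (R := A ⧸ Ideal.ofList xs))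
    obtain ⟨k, rfl⟩ := ENat.ne_top_iff_exists.mp (show m ≠ ⊤ by
      rintro rfl; exact ringKrullDim_ne_top (R := A ⧸ Ideal.ofList xs) hm.symm)
    exact ⟨k, hm.symm⟩
  have h0 : ringKrullDim (A ⧸ Ideal.ofList ([] : List A)) + ([] : List A).length =
      ringKrullDim A := by
    rw [ringKrullDim_quotient_ofList_nil]; simp
  obtain ⟨n, hn⟩ := key [] h0 (by simp)
  obtain ⟨xs, h1, h2, h3⟩ := exists_append_mem_minimalPrimes_ofList p n [] (by simp) hn h0
  rw [List.append_nil] at h1 h2 h3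
  obtain ⟨m, hm⟩ := key xs h3 fun x hx ↦ le_maximalIdeal Ideal.IsPrime.ne_top' (h1 x hx)
  obtain ⟨ys, h4, h5, h6⟩ := exists_append_mem_minimalPrimes_ofList (maximalIdeal A) m xs
    (fun x hx ↦ le_maximalIdeal Ideal.IsPrime.ne_top' (h1 x hx)) hm h3
  have hrad := radical_eq_maximalIdeal_of_mem_minimalPrimes h5
  rw [(radical_eq_maximalIdeal_iff_ringKrullDim (ofList_le_of_forall_mem h4)).mp hrad,
    zero_add] at h6
  exact ⟨xs, ys, IsSOP.perm ⟨h4, h6, hrad⟩ List.perm_append_comm, h2⟩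

end Parameters

section RegularLocal

lemma WithBot.enat_eq_zero_of_add_one_le_one {a : WithBot ℕ∞} (h0 : 0 ≤ a) (h : a + 1 ≤ 1) :
    a = 0 := by
  induction a with
  | bot => exact absurd h0 (by simp)
  | coe a =>
    have h' : a + 1 ≤ 0 + 1 := by
      rw [zero_add]; exact_mod_cast h
    have := (ENat.add_le_add_iff_right ENat.one_ne_top).mp h'
    exact_mod_cast le_antisymm this bot_le

variable {A : Type u} [CommRing A]

lemma maximalIdeal_notMem_minimalPrimes_ofList [IsLocalRing A] [IsNoetherianRing A] {xs : List A}
    (h : ∀ x ∈ xs, x ∈ maximalIdeal A) (hlt : (xs.length : WithBot ℕ∞) < ringKrullDim A) :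
    maximalIdeal A ∉ (Ideal.ofList xs).minimalPrimes := by
  intro hm
  have := ringKrullDim_le_quotient_ofList_add_length h
  rw [(radical_eq_maximalIdeal_iff_ringKrullDim (ofList_le_of_forall_mem h)).mp
    (radical_eq_maximalIdeal_of_mem_minimalPrimes hm), zero_add] at this
  exact absurd hlt this.not_gt

lemma exists_notMem_sq_of_finite_of_isPrime [IsLocalRing A] [IsNoetherianRing A]
    {S : Set (Ideal A)} (hS : S.Finite) (hprime : ∀ p ∈ S, p.IsPrime) (hm : maximalIdeal A ∉ S)
    (hbot : maximalIdeal A ≠ ⊥) :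
    ∃ x ∈ maximalIdeal A, x ∉ maximalIdeal A ^ 2 ∧ ∀ p ∈ S, x ∉ p := by
  by_contra! hcon
  obtain ⟨p, hp, hle⟩ := (Ideal.subset_union_prime_finite (hS.insert (maximalIdeal A ^ 2))
    (f := id) (maximalIdeal A ^ 2) (maximalIdeal A ^ 2)
    (fun p hp hne _ ↦ hprime p (hp.resolve_left hne)) (I := maximalIdeal A)).mp (fun x hx ↦ by
      by_cases hx2 : x ∈ maximalIdeal A ^ 2
      · exact Set.mem_biUnion (Set.mem_insert _ _) hx2
      · obtain ⟨p, hp, hxp⟩ := hcon x hx hx2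
        exact Set.mem_biUnion (Set.mem_insert_of_mem _ hp) hxp)
  obtain rfl | hp := hp
  · refine hbot (Submodule.eq_bot_of_le_smul_of_le_jacobson_bot (maximalIdeal A) _
      (IsNoetherian.noetherian _) ?_ (maximalIdeal_le_jacobson _))
    simpa [pow_two] using! hle
  · have := hprime p hp
    exact hm ((maximalIdeal.isMaximal A).eq_of_le this.ne_top hle ▸ hp)

lemma IsRegularLocalRing.quotient_span_singleton [IsRegularLocalRing A] {x : A}
    (hx : x ∈ maximalIdeal A) (hx2 : x ∉ maximalIdeal A ^ 2)
    (hdim : ringKrullDim (A ⧸ Ideal.span {x}) + 1 = ringKrullDim A) :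
    IsRegularLocalRing (A ⧸ Ideal.span {x}) := by
  classical
  have : Nontrivial (A ⧸ Ideal.span {x}) := Ideal.Quotient.nontrivial_iff.mpr fun h ↦
    (maximalIdeal.isMaximal A).ne_top
      (top_le_iff.mp (h ▸ (Ideal.span_singleton_le_iff_mem _).mpr hx))
  have : IsLocalRing (A ⧸ Ideal.span {x}) :=
    .of_surjective' (Ideal.Quotient.mk _) Ideal.Quotient.mk_surjective
  have hfg : Submodule.FG (maximalIdeal A) := IsNoetherian.noetherian _
  set t := hfg.finite_generators.toFinset with ht
  have hspan : Ideal.span (t : Set A) = maximalIdeal A := by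
    rw [ht, Set.Finite.coe_toFinset]; exact Submodule.span_generators _
  have hcard : (t.card : WithBot ℕ∞) = ringKrullDim A := by
    rw [ht, ← Set.ncard_eq_toFinset_card _ hfg.finite_generators, hfg.generators_ncard,
      IsRegularLocalRing.spanFinrank_maximalIdeal]
  obtain ⟨c, -, hc⟩ := Submodule.mem_span_finset.mp (by rwa [← hspan] at hx)
  obtain ⟨a, hat, hca⟩ : ∃ a ∈ t, IsUnit (c a) := by
    by_contra! hcon
    refine hx2 (hc ▸ Ideal.sum_mem _ fun a ha ↦ ?_)
    rw [pow_two, smul_eq_mul]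
    exact Ideal.mul_mem_mul ((mem_maximalIdeal _).mpr (hcon a ha)) (hspan ▸ Ideal.subset_span ha)
  have hle : maximalIdeal A ≤ Ideal.span (insert x (t.erase a : Set A)) := by
    rw [← hspan, Ideal.span_le]
    intro b hb
    by_cases hba : b = a
    · subst hba
      have hmul : c b * b ∈ Ideal.span (insert x (t.erase b : Set A)) := by
        have : c b * b = x - ∑ i ∈ t.erase b, c i • i := by
          rw [← hc, ← Finset.add_sum_erase t _ hb]; simp
        rw [this]
        exact Ideal.sub_mem _ (Ideal.subset_span (Set.mem_insert _ _)) (Ideal.sum_mem _ fun i hi ↦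
          Ideal.mul_mem_left _ _ (Ideal.subset_span (Set.mem_insert_of_mem _ hi)))
      exact (Ideal.unit_mul_mem_iff_mem _ hca).mp hmul
    · exact Ideal.subset_span (Set.mem_insert_of_mem _ (Finset.mem_erase.mpr ⟨hba, hb⟩))
  have hmax : maximalIdeal (A ⧸ Ideal.span {x}) =
      Ideal.span (Set.image (Ideal.Quotient.mk (Ideal.span {x})) (t.erase a)) := by
    rw [← map_maximalIdeal_of_surjective _ Ideal.Quotient.mk_surjective, ← Ideal.map_span]
    apply le_antisymm
    · refine (Ideal.map_mono hle).trans ?_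
      rw [Ideal.span_insert, Ideal.map_sup, Ideal.map_quotient_self, bot_sup_eq]
    · refine Ideal.map_mono ?_
      rw [← hspan]
      exact Ideal.span_mono (by simp)
  apply IsRegularLocalRing.of_spanFinrank_maximalIdeal_le
  have hrank : (maximalIdeal (A ⧸ Ideal.span {x})).spanFinrank ≤ (t.erase a).card := by
    rw [hmax]
    exact (Submodule.spanFinrank_span_le_ncard_of_finite ((Finset.finite_toSet _).image _)).trans
      ((Set.ncard_image_le (Finset.finite_toSet _)).trans (Set.ncard_coe_finset _).le)
  have hcard' : ringKrullDim (A ⧸ Ideal.span {x}) = ((t.erase a).card : ℕ) := by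
    apply withBot_enat_eq_natCast_of_add_one_eq
    rw [hdim, ← hcard, ← Finset.card_erase_add_one hat]
    norm_cast
  rw [hcard']
  exact_mod_cast hrank

/-- A regular local ring of positive dimension has a regular parameter avoiding a given finite set
of non-maximal primes and the minimal primes. -/
lemma IsRegularLocalRing.exists_isRegularLocalRing_quotient [IsRegularLocalRing A]
    {S : Set (Ideal A)} (hS : S.Finite) (hprime : ∀ p ∈ S, p.IsPrime) (hm : maximalIdeal A ∉ S)
    (hdim : 0 < ringKrullDim A) :
    ∃ x ∈ maximalIdeal A, (∀ p ∈ S, x ∉ p) ∧ (∀ p ∈ minimalPrimes A, x ∉ p) ∧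
      ringKrullDim (A ⧸ Ideal.span {x}) + 1 = ringKrullDim A ∧
      IsRegularLocalRing (A ⧸ Ideal.span {x}) := by
  have hmin : maximalIdeal A ∉ minimalPrimes A := by
    have := maximalIdeal_notMem_minimalPrimes_ofList (A := A) (xs := []) (by simp) (by simp [hdim])
    rwa [Ideal.ofList_nil] at this
  obtain ⟨x, hx, hx2, hxS⟩ := exists_notMem_sq_of_finite_of_isPrime (S := S ∪ minimalPrimes A)
    (hS.union (minimalPrimes.finite_of_isNoetherianRing A))
    (fun p hp ↦ hp.elim (hprime p) fun h ↦ h.1.1) (fun h ↦ h.elim hm hmin) (by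
      intro hbot
      have : (⊥ : Ideal A).IsPrime := hbot ▸ (maximalIdeal.isMaximal A).isPrime
      exact hmin (by rw [hbot]; exact ⟨⟨this, le_rfl⟩, fun _ _ _ ↦ bot_le⟩))
  have hd := ringKrullDim_quotient_ofList_cons_add_one (x := x) (xs := [])
    (by rw [Ideal.ofList_nil]; exact fun p hp ↦ hxS p (.inr hp)) hx
  rw [ringKrullDim_quotient_ofList_nil, Ideal.ofList_singleton] at hd
  exact ⟨x, hx, fun p hp ↦ hxS p (.inl hp), fun p hp ↦ hxS p (.inr hp), hd,
    .quotient_span_singleton hx hx2 hd⟩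

lemma IsRegularLocalRing.exists_ringKrullDim_eq (A : Type*) [CommRing A] [IsRegularLocalRing A] :
    ∃ n : ℕ, ringKrullDim A = n :=
  ⟨_, IsRegularLocalRing.spanFinrank_maximalIdeal.symm⟩

lemma IsRegularLocalRing.maximalIdeal_eq_bot [IsRegularLocalRing A] (h : ringKrullDim A = 0) :
    maximalIdeal A = ⊥ := by
  have h1 := IsRegularLocalRing.spanFinrank_maximalIdeal (R := A)
  rw [h] at h1
  exact (Submodule.spanFinrank_eq_zero_iff_eq_bot (IsNoetherian.noetherian _)).mp
    (by exact_mod_cast h1)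

instance IsRegularLocalRing.isDomain [IsRegularLocalRing A] : IsDomain A := by
  obtain ⟨n, hn⟩ := exists_ringKrullDim_eq A
  induction n generalizing A with
  | zero =>
    have := IsRegularLocalRing.maximalIdeal_eq_bot (A := A) (by simpa using hn)
    have : (⊥ : Ideal A).IsPrime := this ▸ (maximalIdeal.isMaximal A).isPrime
    exact IsDomain.of_bot_isPrime A
  | succ n ih =>
    obtain ⟨x, hx, -, hmin, hdim, hreg⟩ := exists_isRegularLocalRing_quotient (A := A)
      Set.finite_empty (by simp) (by simp) (by rw [hn]; exact_mod_cast n.succ_pos)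
    have := ih (A := A ⧸ Ideal.span {x})
      (withBot_enat_eq_natCast_of_add_one_eq (by rw [hdim, hn]; norm_cast))
    have hprime : (Ideal.span {x}).IsPrime := (Ideal.Quotient.isDomain_iff_prime _).mp this
    obtain ⟨p, hp, hle⟩ := Ideal.exists_minimalPrimes_le (bot_le (a := Ideal.span {x}))
    have hpp := hp.isPrime
    have hbot : p = ⊥ := by
      refine Submodule.eq_bot_of_le_smul_of_le_jacobson_bot (Ideal.span {x}) p
        (IsNoetherian.noetherian _) (fun y hy ↦ ?_)
        (((Ideal.span_singleton_le_iff_mem _).mpr hx).trans (maximalIdeal_le_jacobson _))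
      obtain ⟨a, rfl⟩ := Ideal.mem_span_singleton'.mp (hle hy)
      rw [mul_comm]
      exact Submodule.smul_mem_smul (Ideal.mem_span_singleton_self x)
        ((hpp.mem_or_mem hy).resolve_right (hmin p hp))
    have : (⊥ : Ideal A).IsPrime := hbot ▸ hpp
    exact IsDomain.of_bot_isPrime A

lemma IsSOP.map_mk [IsLocalRing A] {x : A} {ys : List A} [IsLocalRing (A ⧸ Ideal.span {x})]
    (h : IsSOP A (x :: ys))
    (hdim : ringKrullDim (A ⧸ Ideal.span {x}) + 1 = ringKrullDim A) :
    IsSOP (A ⧸ Ideal.span {x}) (ys.map (Ideal.Quotient.mk (Ideal.span {x}))) := by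
  have hmap := map_maximalIdeal_of_surjective (Ideal.Quotient.mk (Ideal.span {x}))
    Ideal.Quotient.mk_surjective
  have hle : Ideal.span {x} ≤ Ideal.ofList (x :: ys) := by rw [Ideal.ofList_cons]; exact le_sup_left
  rw [isSOP_iff_ofList] at h ⊢
  refine ⟨fun y hy ↦ ?_, ?_, ?_⟩
  · obtain ⟨z, hz, rfl⟩ := List.mem_map.mp hy
    exact hmap ▸ Ideal.mem_map_of_mem _ (h.1 z (List.mem_cons_of_mem _ hz))
  · rw [List.length_map]
    refine (withBot_enat_eq_natCast_of_add_one_eq ?_).symm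
    rw [hdim, ← h.2.1, List.length_cons]
    norm_cast
  · rw [← hmap, ← h.2.2, Ideal.map_radical_of_surjective Ideal.Quotient.mk_surjective
      (by rwa [Ideal.mk_ker]), Ideal.ofList_cons, Ideal.map_sup, Ideal.map_quotient_self,
      bot_sup_eq, Ideal.map_ofList]

lemma isWeaklyRegular_cons_of_quotient [IsDomain A] {x : A} {ys : List A} (hx : x ≠ 0)
    (h : IsWeaklyRegular (A ⧸ Ideal.span {x}) (ys.map (Ideal.Quotient.mk (Ideal.span {x})))) :
    IsWeaklyRegular A (x :: ys) := by
  refine .cons (IsSMulRegular.of_ne_zero hx) ?_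
  have hA := (isWeaklyRegular_map_algebraMap_iff (A ⧸ Ideal.span {x}) (A ⧸ Ideal.span {x}) ys).mp h
  exact ((Submodule.quotEquivOfEq _ _ (by
    rw [← Submodule.ideal_span_singleton_smul, smul_eq_mul, Ideal.mul_top])).isWeaklyRegular_congr
      ys).mp hA

/-- Regular local rings are Cohen-Macaulay. -/
lemma IsRegularLocalRing.isWeaklyRegular_of_isSOP [IsRegularLocalRing A] {xs : List A}
    (h : IsSOP A xs) : IsWeaklyRegular A xs := by
  obtain ⟨n, hn⟩ := exists_ringKrullDim_eq A
  induction n generalizing A with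
  | zero =>
    have hlen := h.2.1
    rw [hn] at hlen
    obtain rfl := List.length_eq_zero_iff.mp (by exact_mod_cast hlen : xs.length = 0)
    exact .nil A A
  | succ n ih =>
    obtain rfl | ⟨ys, y, rfl⟩ := xs.eq_nil_or_concat'
    · exact .nil A A
    have hmem := h.1
    have hmem' : ∀ z ∈ ys, z ∈ maximalIdeal A := fun z hz ↦ hmem z (by simp [hz])
    have hdimA : ringKrullDim A = ys.length + 1 := by rw [← h.2.1]; simp
    have hmax : maximalIdeal A ∉ (Ideal.ofList ys).minimalPrimes :=
      maximalIdeal_notMem_minimalPrimes_ofList hmem' (by rw [hdimA]; norm_cast; simp)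
    obtain ⟨x, hx, hxS, hmin, hdim, hreg⟩ := exists_isRegularLocalRing_quotient (A := A)
      (Ideal.finite_minimalPrimes_of_isNoetherianRing A (Ideal.ofList ys))
      (fun p hp ↦ hp.isPrime) hmax (by rw [hn]; exact_mod_cast n.succ_pos)
    have hcons : ∀ z ∈ x :: ys, z ∈ maximalIdeal A := List.forall_mem_cons.mpr ⟨hx, hmem'⟩
    have hsop : IsSOP A (x :: ys) := by
      rw [isSOP_iff_ofList]
      refine ⟨hcons, by rw [hdimA]; simp, ?_⟩
      have hle := ofList_le_of_forall_mem hcons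
      rw [radical_eq_maximalIdeal_iff_ringKrullDim hle]
      have : Nontrivial (A ⧸ Ideal.ofList (x :: ys)) := Ideal.Quotient.nontrivial_iff.mpr fun h ↦
        (maximalIdeal.isMaximal A).ne_top (top_le_iff.mp (h ▸ hle))
      refine WithBot.enat_eq_zero_of_add_one_le_one ringKrullDim_nonneg_of_nontrivial ?_
      rw [ringKrullDim_quotient_ofList_cons_add_one hxS hx]
      have hy := h.perm (List.perm_append_singleton y ys)
      have := ringKrullDim_quotient_ofList_le_cons (xs := ys) (hy.1 y List.mem_cons_self)
      rwa [(radical_eq_maximalIdeal_iff_ringKrullDim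
        (ofList_le_of_forall_mem hy.1)).mp hy.2.2, zero_add] at this
    have hx0 : x ≠ 0 := fun h ↦ by
      obtain ⟨p, hp, -⟩ := Ideal.exists_minimalPrimes_le (bot_le (a := maximalIdeal A))
      exact hmin p hp (h ▸ p.zero_mem)
    have hwr : IsWeaklyRegular A (x :: ys) := isWeaklyRegular_cons_of_quotient hx0
      (ih (hsop.map_mk hdim)
        (withBot_enat_eq_natCast_of_add_one_eq (by rw [hdim, hn]; norm_cast)))
    have hwr' := isWeaklyRegular_of_perm_of_subset_maximalIdeal hwr
      (List.perm_append_singleton x ys).symm hcons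
    rw [isWeaklyRegular_append_iff, isWeaklyRegular_singleton_iff] at hwr' ⊢
    refine ⟨hwr'.1, ?_⟩
    obtain ⟨k, hk⟩ := (h.2.2 ▸ hx : x ∈ (Ideal.ofList (ys ++ [y])).radical)
    change x ^ k ∈ Ideal.ofList (ys ++ [y]) at hk
    rw [Ideal.ofList_append, Ideal.ofList_singleton] at hk
    obtain ⟨a, ha, b, hb, hab⟩ := Submodule.mem_sup.mp hk
    obtain ⟨c, rfl⟩ := Ideal.mem_span_singleton'.mp hb
    refine isSMulRegular_iff_right_eq_zero_of_smul.mpr fun z hz ↦ ?_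
    refine isSMulRegular_iff_right_eq_zero_of_smul.mp (hwr'.2.pow k) z ?_
    obtain ⟨w, rfl⟩ := Submodule.Quotient.mk_surjective _ z
    rw [← hab, add_smul, mul_smul, hz, smul_zero, add_zero, ← Submodule.Quotient.mk_smul,
      Submodule.Quotient.mk_eq_zero]
    exact Submodule.smul_mem_smul ha trivial

end RegularLocal

section Syzygies

/-- All `n`-th syzygies of `M` with respect to finite free covers satisfy `P`. -/
def SyzygiesSatisfy {A : Type u} [CommRing A]
    (P : ∀ (M : Type u) [AddCommGroup M] [Module A M], Prop) :
    ℕ → ∀ (M : Type u) [AddCommGroup M] [Module A M], Prop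
  | 0, M, _, _ => P M
  | n + 1, M, _, _ => ∀ (m : ℕ) (f : (Fin m → A) →ₗ[A] M), Function.Surjective f →
      SyzygiesSatisfy P n (LinearMap.ker f)

variable {A : Type u} [CommRing A]

lemma SyzygiesSatisfy.mono {P Q : ∀ (M : Type u) [AddCommGroup M] [Module A M], Prop}
    (hPQ : ∀ (M : Type u) [AddCommGroup M] [Module A M], P M → Q M) (n : ℕ) (M : Type u)
    [AddCommGroup M] [Module A M] (h : SyzygiesSatisfy P n M) : SyzygiesSatisfy Q n M := by
  induction n generalizing M with
  | zero => exact hPQ M h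
  | succ n ih => exact fun m f hf ↦ ih _ (h m f hf)

open Pointwise in
lemma Module.Free.of_surjective_of_ker_eq_smul_top [IsLocalRing A] {x : A}
    (hx : x ∈ maximalIdeal A) {K : Type*} [AddCommGroup K] [Module A K]
    [Module.FinitePresentation A K] (hK : IsSMulRegular K x) {N : Type*} [AddCommGroup N]
    [Module A N] [Module (A ⧸ Ideal.span {x}) N] [IsScalarTower A (A ⧸ Ideal.span {x}) N]
    [Module.Free (A ⧸ Ideal.span {x}) N] (π : K →ₗ[A] N) (hπ : Function.Surjective π)
    (hker : LinearMap.ker π = x • ⊤) : Module.Free A K := by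
  rw [← Module.free_quotSMulTop_iff_free A K (maximalIdeal_le_jacobson _ hx) hK]
  exact Module.Free.of_equiv (((Submodule.quotEquivOfEq _ _ hker.symm).trans
    (π.quotKerEquivOfSurjective hπ)).extendScalarsOfSurjective
      (S := A ⧸ Ideal.span {x}) Ideal.Quotient.mk_surjective).symm

open Pointwise in
lemma SyzygiesSatisfy.free_of_quotient_span_singleton [IsLocalRing A] [IsNoetherianRing A] {x : A}
    (hx : x ∈ maximalIdeal A) (hA : IsSMulRegular A x) (n : ℕ) (K : Type u) [AddCommGroup K]
    [Module A K] [Module.Finite A K] (hK : IsSMulRegular K x) (N : Type u) [AddCommGroup N]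
    [Module A N] [Module (A ⧸ Ideal.span {x}) N] [IsScalarTower A (A ⧸ Ideal.span {x}) N]
    (π : K →ₗ[A] N) (hπ : Function.Surjective π) (hker : LinearMap.ker π = x • ⊤)
    (h : SyzygiesSatisfy (A := A ⧸ Ideal.span {x})
      (fun M _ _ ↦ Module.Free (A ⧸ Ideal.span {x}) M) n N) :
    SyzygiesSatisfy (A := A) (fun M _ _ ↦ Module.Free A M) n K := by
  induction n generalizing K N with
  | zero =>
    have : Module.Free (A ⧸ Ideal.span {x}) N := h
    have := Module.finitePresentation_of_finite A K
    exact Module.Free.of_surjective_of_ker_eq_smul_top hx hK π hπ hker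
  | succ n ih =>
    intro m f hf
    let red : (Fin m → A) →ₗ[A] (Fin m → A ⧸ Ideal.span {x}) :=
      (Algebra.linearMap A (A ⧸ Ideal.span {x})).compLeft (Fin m)
    have hred : Function.Surjective red := fun w ↦ by
      choose v hv using fun i ↦ Ideal.Quotient.mk_surjective (w i)
      exact ⟨v, funext hv⟩
    have hxred (u : Fin m → A) : x • red u = 0 := by
      have : (algebraMap A (A ⧸ Ideal.span {x})) x = 0 :=
        Ideal.Quotient.eq_zero_iff_mem.mpr (Ideal.mem_span_singleton_self x)
      funext i
      rw [Pi.smul_apply, Algebra.smul_def, this, zero_mul, Pi.zero_apply]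
    let g := Fintype.linearCombination (A ⧸ Ideal.span {x}) fun i ↦ π (f (Pi.single i 1))
    have hg (v : Fin m → A) : g (red v) = π (f v) := by
      have hv : v = ∑ i, v i • Pi.single i (1 : A) := by
        simpa using (pi_eq_sum_univ' v)
      conv_rhs => rw [hv]
      simp only [g, Fintype.linearCombination_apply, map_sum, map_smul]
      refine Finset.sum_congr rfl fun i _ ↦ ?_
      exact algebraMap_smul (A ⧸ Ideal.span {x}) (v i) _
    have hgs : Function.Surjective g := fun y ↦ by
      obtain ⟨k, rfl⟩ := hπ y
      obtain ⟨v, rfl⟩ := hf k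
      exact ⟨red v, hg v⟩
    have hFin : IsSMulRegular (Fin m → A) x := fun v w hvw ↦
      funext fun i ↦ hA (congrFun hvw i)
    have hmem {k : K} : π k = 0 ↔ ∃ k', x • k' = k := by
      rw [← LinearMap.mem_ker, hker, Submodule.mem_smul_pointwise_iff_exists]; simp
    let ρ : LinearMap.ker f →ₗ[A] LinearMap.ker g :=
      { toFun := fun v ↦ ⟨red v, by rw [LinearMap.mem_ker, hg, v.2, map_zero]⟩
        map_add' := fun v w ↦ Subtype.ext (by simp)
        map_smul' := fun a v ↦ Subtype.ext (by simp) }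
    refine ih (LinearMap.ker f) (hFin.submodule _ _) (LinearMap.ker g) ρ ?_ ?_ (h m g hgs)
    · rintro ⟨w, hw⟩
      obtain ⟨v, rfl⟩ := hred w
      rw [LinearMap.mem_ker, hg, hmem] at hw
      obtain ⟨k, hk⟩ := hw
      obtain ⟨u, rfl⟩ := hf k
      refine ⟨⟨v - x • u, by simp [hk]⟩, Subtype.ext ?_⟩
      change red (v - x • u) = red v
      rw [map_sub, map_smul, hxred, sub_zero]
    · ext ⟨v, hv⟩
      rw [LinearMap.mem_ker, Submodule.mem_smul_pointwise_iff_exists]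
      constructor
      · intro h0
        have h1 (i : Fin m) : ∃ a, a * x = v i :=
          Ideal.mem_span_singleton'.mp (Ideal.Quotient.eq_zero_iff_mem.mp
            (congrFun (congrArg Subtype.val h0) i))
        choose u hu using h1
        have hxu : x • u = v := funext fun i ↦ by simpa [mul_comm] using hu i
        refine ⟨⟨u, ?_⟩, trivial, Subtype.ext hxu⟩
        apply hK
        change x • f u = x • 0
        rw [← map_smul, hxu, smul_zero]
        exact hv
      · rintro ⟨u, -, hu⟩
        rw [← hu, map_smul]
        exact Subtype.ext (hxred u)

/-- Hilbert's syzygy theorem for regular local rings. -/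
lemma IsRegularLocalRing.syzygiesSatisfy_free [IsRegularLocalRing A] (n : ℕ)
    (hn : ringKrullDim A = n) (M : Type u) [AddCommGroup M] [Module A M] :
    SyzygiesSatisfy (A := A) (fun M _ _ ↦ Module.Free A M) n M := by
  induction n generalizing A M with
  | zero =>
    let := (isField_iff_maximalIdeal_eq.mpr
      (maximalIdeal_eq_bot (A := A) (by simpa using hn))).toField
    exact Module.Free.of_divisionRing A M
  | succ n ih =>
    intro m f hf
    obtain ⟨x, hx, -, hmin, hdim, hreg⟩ := exists_isRegularLocalRing_quotient (A := A)
      Set.finite_empty (by simp) (by simp) (by rw [hn]; exact_mod_cast n.succ_pos)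
    have hx0 : x ≠ 0 := fun h ↦ by
      obtain ⟨p, hp, -⟩ := Ideal.exists_minimalPrimes_le (bot_le (a := maximalIdeal A))
      exact hmin p hp (h ▸ p.zero_mem)
    have hA : IsSMulRegular A x := IsSMulRegular.of_ne_zero hx0
    have hFin : IsSMulRegular (Fin m → A) x := fun v w hvw ↦
      funext fun i ↦ hA (congrFun hvw i)
    exact SyzygiesSatisfy.free_of_quotient_span_singleton hx hA n _ (hFin.submodule _ _)
      (QuotSMulTop x (LinearMap.ker f)) (Submodule.mkQ _) (Submodule.mkQ_surjective _)
      (Submodule.ker_mkQ _)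
      (ih (withBot_enat_eq_natCast_of_add_one_eq (by rw [hdim, hn]; norm_cast)) _)

end Syzygies

section TorOne

open Function TensorProduct

variable {A : Type u} [CommRing A]

lemma lTensor_injective_of_rTensor_injective {K F M L G B : Type*}
    [AddCommGroup K] [Module A K] [AddCommGroup F] [Module A F] [AddCommGroup M] [Module A M]
    [AddCommGroup L] [Module A L] [AddCommGroup G] [Module A G] [AddCommGroup B] [Module A B]
    [Module.Flat A F] {i : K →ₗ[A] F} {p : F →ₗ[A] M} (hip : Exact i p) (hp : Surjective p)
    {j : L →ₗ[A] G} {q : G →ₗ[A] B} (hj : Injective j) (hjq : Exact j q) (hq : Surjective q)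
    (h : Injective (i.rTensor B)) : Injective (j.lTensor M) := by
  rw [injective_iff_map_eq_zero]
  intro z hz
  obtain ⟨y, rfl⟩ := LinearMap.rTensor_surjective L hp z
  have h1 : p.rTensor G (j.lTensor F y) = 0 := by
    rw [← hz, ← LinearMap.comp_apply, ← LinearMap.comp_apply, LinearMap.rTensor_comp_lTensor,
      LinearMap.lTensor_comp_rTensor]
  obtain ⟨k, hk⟩ := (rTensor_exact G hip hp _).mp h1
  have h2 : q.lTensor K k = 0 := by
    apply h
    rw [map_zero, ← LinearMap.comp_apply, LinearMap.rTensor_comp_lTensor,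
      ← LinearMap.lTensor_comp_rTensor, LinearMap.comp_apply, hk, ← LinearMap.comp_apply,
      ← LinearMap.lTensor_comp, hjq.linearMap_comp_eq_zero, LinearMap.lTensor_zero,
      LinearMap.zero_apply]
  obtain ⟨l, rfl⟩ := (lTensor_exact K hjq hq _).mp h2
  have h3 : i.rTensor L l = y := by
    apply Module.Flat.lTensor_preserves_injective_linearMap (M := F) j hj
    rw [← hk, ← LinearMap.comp_apply, ← LinearMap.comp_apply, LinearMap.lTensor_comp_rTensor,
      LinearMap.rTensor_comp_lTensor]
  rw [← h3, ← LinearMap.comp_apply, ← LinearMap.rTensor_comp, hip.linearMap_comp_eq_zero,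
    LinearMap.rTensor_zero, LinearMap.zero_apply]

/-- The free module on the elements of `B`. -/
def FreeCover (A : Type*) [CommRing A] (B : Type*) : Type _ := B →₀ A

namespace FreeCover

variable (A) (B : Type*)

noncomputable instance : AddCommGroup (FreeCover A B) := inferInstanceAs (AddCommGroup (B →₀ A))

noncomputable instance : Module A (FreeCover A B) := inferInstanceAs (Module A (B →₀ A))

instance : Module.Free A (FreeCover A B) := inferInstanceAs (Module.Free A (B →₀ A))

/-- The tautological surjection from the free module on the elements of `B` onto `B`. -/
noncomputable def proj [AddCommGroup B] [Module A B] : FreeCover A B →ₗ[A] B :=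
  Finsupp.linearCombination A (id : B → B)

lemma proj_surjective [AddCommGroup B] [Module A B] : Surjective (proj A B) :=
  Finsupp.linearCombination_id_surjective A B

end FreeCover

/-- The kernel of the tautological free cover of `B`. -/
noncomputable def firstSyzygy (A : Type*) [CommRing A] (B : Type*) [AddCommGroup B] [Module A B] :
    Submodule A (FreeCover A B) :=
  LinearMap.ker (FreeCover.proj A B)

/-- The vanishing of `Tor₁(M, B)`, expressed through the tautological free cover of `B`. -/
def TorOneVanishes (A : Type*) [CommRing A] (M B : Type*) [AddCommGroup M] [Module A M]
    [AddCommGroup B] [Module A B] : Prop :=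
  Injective ((firstSyzygy A B).subtype.lTensor M)

section Module

variable {M B : Type*} [AddCommGroup M] [Module A M] [AddCommGroup B] [Module A B]

variable (A B) in
lemma exact_firstSyzygy_subtype : Exact (firstSyzygy A B).subtype (FreeCover.proj A B) :=
  LinearMap.exact_subtype_ker_map _

lemma TorOneVanishes.of_flat [Module.Flat A M] : TorOneVanishes A M B :=
  Module.Flat.lTensor_preserves_injective_linearMap _ (Submodule.subtype_injective _)

lemma TorOneVanishes.firstSyzygy_of_ker {F : Type*} [AddCommGroup F] [Module A F]
    [Module.Flat A F] {f : F →ₗ[A] M} (hf : Surjective f)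
    (h : TorOneVanishes A (LinearMap.ker f) B) : TorOneVanishes A M (firstSyzygy A B) := by
  refine lTensor_injective_of_rTensor_injective (LinearMap.exact_subtype_ker_map f) hf
    (Submodule.subtype_injective _) (exact_firstSyzygy_subtype A _)
    (FreeCover.proj_surjective A _) ?_
  apply Injective.of_comp (f := (firstSyzygy A B).subtype.lTensor F)
  rw [← LinearMap.coe_comp, LinearMap.lTensor_comp_rTensor, ← LinearMap.rTensor_comp_lTensor,
    LinearMap.coe_comp]
  exact (Module.Flat.rTensor_preserves_injective_linearMap (M := FreeCover A B) _
    (Submodule.subtype_injective _)).comp h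

lemma Module.Flat.of_torOneVanishes (h : ∀ I : Ideal A, TorOneVanishes A (A ⧸ I) B) :
    Module.Flat A B := by
  rw [Module.Flat.iff_lTensor_injective']
  intro I
  exact lTensor_injective_of_rTensor_injective (exact_firstSyzygy_subtype A B)
    (FreeCover.proj_surjective A B) (Submodule.subtype_injective _)
    (LinearMap.exact_subtype_mkQ I) (Submodule.mkQ_surjective I)
    ((LinearMap.lTensor_inj_iff_rTensor_inj _ _).mp (h I))

lemma TorOneVanishes.of_exact {N₁ N₂ N₃ : Type*} [AddCommGroup N₁] [Module A N₁]
    [AddCommGroup N₂] [Module A N₂] [AddCommGroup N₃] [Module A N₃] {f : N₁ →ₗ[A] N₂}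
    {g : N₂ →ₗ[A] N₃} (hf : Injective f) (hg : Surjective g) (hfg : Exact f g)
    (h₁ : TorOneVanishes A N₁ B) (h₃ : TorOneVanishes A N₃ B) : TorOneVanishes A N₂ B := by
  refine (injective_iff_map_eq_zero _).mpr fun z hz ↦ ?_
  have h0 : g.rTensor (firstSyzygy A B) z = 0 := by
    apply h₃
    rw [map_zero, ← LinearMap.comp_apply, LinearMap.lTensor_comp_rTensor,
      ← LinearMap.rTensor_comp_lTensor, LinearMap.comp_apply, hz, map_zero]
  obtain ⟨y, rfl⟩ := (rTensor_exact _ hfg hg _).mp h0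
  have hy : (firstSyzygy A B).subtype.lTensor N₁ y = 0 := by
    apply Module.Flat.rTensor_preserves_injective_linearMap (M := FreeCover A B) f hf
    rw [map_zero, ← hz, ← LinearMap.comp_apply, ← LinearMap.comp_apply,
      LinearMap.lTensor_comp_rTensor, LinearMap.rTensor_comp_lTensor]
  rw [(injective_iff_map_eq_zero _).mp h₁ y hy, map_zero]

lemma TorOneVanishes.of_injective [Module.Flat A (firstSyzygy A B)] {N : Type*} [AddCommGroup N]
    [Module A N] {f : N →ₗ[A] M} (hf : Injective f) (h : TorOneVanishes A M B) :
    TorOneVanishes A N B := by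
  apply Injective.of_comp (f := f.rTensor (FreeCover A B))
  rw [← LinearMap.coe_comp, LinearMap.rTensor_comp_lTensor, ← LinearMap.lTensor_comp_rTensor,
    LinearMap.coe_comp]
  exact h.comp (Module.Flat.rTensor_preserves_injective_linearMap f hf)

lemma mapQ_firstSyzygy_subtype_injective {xs : List A} (h : IsWeaklyRegular B xs) :
    Injective (Submodule.mapQ _ (Ideal.ofList xs • ⊤ : Submodule A (FreeCover A B)) _
      (Submodule.smul_top_le_comap_smul_top (Ideal.ofList xs)
      (firstSyzygy A B).subtype)) := by
  have hexact : Exact (0 : PUnit →ₗ[A] firstSyzygy A B) (firstSyzygy A B).subtype := by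
    rw [LinearMap.exact_zero_iff_injective]
    exact Submodule.subtype_injective _
  have := map_first_exact_on_four_term_right_exact_of_isSMulRegular_last hexact
    (exact_firstSyzygy_subtype A B) (FreeCover.proj_surjective A B) h
  rw [injective_iff_map_eq_zero]
  intro z hz
  obtain ⟨y, rfl⟩ := (this z).mp hz
  rw [Subsingleton.elim y 0, map_zero]

lemma isWeaklyRegular_firstSyzygy {xs : List A} (hA : IsWeaklyRegular A xs)
    (hB : IsWeaklyRegular B xs) : IsWeaklyRegular (firstSyzygy A B) xs := by
  have hG : IsWeaklyRegular (FreeCover A B) xs :=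
    ((TensorProduct.rid A (FreeCover A B)).isWeaklyRegular_congr xs).mp (hA.isWeaklyRegular_lTensor)
  refine ⟨fun i hi ↦ IsSMulRegular.of_injective _ (mapQ_firstSyzygy_subtype_injective ?_)
    (hG.regular_mod_prev i hi)⟩
  rw [← xs.take_append_drop i, isWeaklyRegular_append_iff] at hB
  exact hB.1

lemma TorOneVanishes.quotient_ofList {xs : List A} (h : IsWeaklyRegular B xs) :
    TorOneVanishes A (A ⧸ Ideal.ofList xs) B := by
  refine (injective_iff_map_eq_zero _).mpr fun z hz ↦ ?_
  obtain ⟨y, rfl⟩ := (quotTensorEquivQuotSMul (firstSyzygy A B) (Ideal.ofList xs)).symm.surjective z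
  obtain ⟨y, rfl⟩ := Submodule.Quotient.mk_surjective _ y
  have hy := congrArg (quotTensorEquivQuotSMul (FreeCover A B) (Ideal.ofList xs)) hz
  rw [quotTensorEquivQuotSMul_symm_mk, LinearMap.lTensor_tmul, map_zero,
    quotTensorEquivQuotSMul_mk_one_tmul] at hy
  rw [(injective_iff_map_eq_zero _).mp (mapQ_firstSyzygy_subtype_injective h)
    (Submodule.Quotient.mk y) hy, map_zero]

end Module

lemma SyzygiesSatisfy.torOneVanishes_firstSyzygy [IsNoetherianRing A] {B : Type*} [AddCommGroup B]
    [Module A B] (n : ℕ) (M : Type u) [AddCommGroup M] [Module A M] [Module.Finite A M]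
    (h : SyzygiesSatisfy (A := A) (fun M _ _ ↦ TorOneVanishes A M B) (n + 1) M) :
    SyzygiesSatisfy (A := A) (fun M _ _ ↦ TorOneVanishes A M (firstSyzygy A B)) n M := by
  induction n generalizing M with
  | zero =>
    obtain ⟨m, f, hf⟩ := Module.Finite.exists_fin' A M
    exact TorOneVanishes.firstSyzygy_of_ker hf (h m f hf)
  | succ n ih => exact fun m f hf ↦ ih _ (h m f hf)

section BalancedBigCM

variable [IsLocalRing A]

lemma TorOneVanishes.of_forall_isSOP [IsNoetherianRing A] {B : Type*} [AddCommGroup B] [Module A B]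
    (hB : ∀ xs, IsSOP A xs → IsWeaklyRegular B xs) [Module.Flat A (firstSyzygy A B)]
    (M : Type u) [AddCommGroup M] [Module A M] [Module.Finite A M] : TorOneVanishes A M B := by
  induction ‹Module.Finite A M› using
    IsNoetherianRing.induction_on_isQuotientEquivQuotientPrime A with
  | subsingleton N => exact TorOneVanishes.of_flat
  | quotient N p e =>
    obtain ⟨xs, ys, hxy, hp⟩ := exists_isSOP_append_mem_minimalPrimes p.asIdeal
    have hxs : IsWeaklyRegular B xs :=
      ((isWeaklyRegular_append_iff B xs ys).mp (hB _ hxy)).1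
    rw [← Ideal.annihilator_quotient (I := Ideal.ofList xs)] at hp
    obtain ⟨-, f, hf⟩ := (isAssociatedPrime_iff_exists_injective_linearMap _ _).mp
      (Module.associatedPrimes.minimalPrimes_annihilator_subset_associatedPrimes A _ hp)
    exact .of_injective (f := f ∘ₗ e.toLinearMap) (hf.comp e.injective) (.quotient_ofList hxs)
  | exact N₁ N₂ N₃ f g hf hg hfg h₁ h₃ => exact TorOneVanishes.of_exact hf hg hfg h₁ h₃

lemma Module.Flat.of_syzygiesSatisfy_torOneVanishes [IsNoetherianRing A]
    (hA : ∀ xs, IsSOP A xs → IsWeaklyRegular A xs) (n : ℕ) (B : Type (max u v)) [AddCommGroup B]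
    [Module A B] (hB : ∀ xs, IsSOP A xs → IsWeaklyRegular B xs)
    (h : ∀ (M : Type u) [AddCommGroup M] [Module A M] [Module.Finite A M],
      SyzygiesSatisfy (A := A) (fun M _ _ ↦ TorOneVanishes A M B) n M) : Module.Flat A B := by
  induction n generalizing B with
  | zero => exact .of_torOneVanishes fun I ↦ h _
  | succ n ih =>
    have : Module.Flat A (firstSyzygy A B) :=
      ih _ (fun xs hxs ↦ isWeaklyRegular_firstSyzygy (hA xs hxs) (hB xs hxs))
        fun M _ _ _ ↦ (h M).torOneVanishes_firstSyzygy
    exact .of_torOneVanishes fun I ↦ .of_forall_isSOP hB _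

lemma IsRegularLocalRing.flat_of_forall_isSOP {A : Type u} [CommRing A] [IsRegularLocalRing A]
    {B : Type v} [AddCommGroup B] [Module A B] (hB : ∀ xs, IsSOP A xs → IsWeaklyRegular B xs) :
    Module.Flat A B := by
  obtain ⟨n, hn⟩ := IsRegularLocalRing.exists_ringKrullDim_eq A
  have : Module.Flat A (ULift.{u} B) :=
    .of_syzygiesSatisfy_torOneVanishes.{u, v} (fun _ ↦ isWeaklyRegular_of_isSOP) n _
      (fun xs hxs ↦ (ULift.moduleEquiv.isWeaklyRegular_congr xs).mpr (hB xs hxs)) fun M _ _ _ ↦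
      SyzygiesSatisfy.mono (fun _ _ _ h ↦ have : Module.Free A _ := h; .of_flat) n M
        (syzygiesSatisfy_free n hn M)
  exact .of_linearEquiv ULift.moduleEquiv.symm

lemma IsRegularLocal.isRegularLocalRing (h : IsRegularLocal A) : IsRegularLocalRing A := by
  obtain ⟨hN, s, hs, hcard⟩ := h
  refine IsRegularLocalRing.of_spanFinrank_maximalIdeal_le A ?_
  rw [← hs, ← hcard]
  have := Submodule.spanFinrank_span_le_ncard_of_finite (R := A) s.finite_toSet
  rw [Set.ncard_coe_finset] at this
  exact_mod_cast this

end BalancedBigCM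

end TorOne

/-- A balanced big Cohen-Macaulay algebra over a Noetherian regular local ring is faithfully
flat. -/
theorem faithfullyFlat_of_balancedBigCM (A : Type u) (B : Type v) [CommRing A]
    [IsNoetherianRing A] [IsLocalRing A] (hreg : IsRegularLocal A) [CommRing B] [Algebra A B]
    (hBCM : IsBalancedBigCM A B) : Module.FaithfullyFlat A B := by
  have := hreg.isRegularLocalRing
  have := IsRegularLocalRing.flat_of_forall_isSOP hBCM.2
  refine ⟨fun m hm h ↦ hBCM.1 ?_⟩
  rw [eq_maximalIdeal hm, Ideal.smul_top_eq_map] at h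
  simpa using h
end
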